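/- Let (A_S,S) be an Artin-Tits system of spherical type and X ⊆ S, and let p: A_S → W_S be the canonical projection onto the Coxeter group. Then p(H_X) = G_X, where G_X = {w ∈ W_S : w·Π_X = Π_X} is the stabilizer in W_S of the set of simple roots indexed by X. -/

import Mathlib

/-!
Common definitions for formalizing "Normalisateur des sous-groupes paraboliques
des groupes d'Artin-Tits" (E. Godelle).

We fix a Coxeter matrix `M` over a finite index set `B` (Mathlib's convention:
`M s t = 0` encodes `m_{s,t} = ∞`).  The Artin-Tits group `Artin M` is the
presented group on the braid relations, the Coxeter group is Mathlib's
`M.Group`, and `proj : Artin M →* M.Group` is the canonical projection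
(adding the relations `s² = 1`).
-/

namespace ArtinTitsPaper

open List

variable {B : Type*}

/-- The alternating list `[s, t, s, t, ...]` with `n` terms, starting with `s`. -/
def altList (s t : B) : ℕ → List B
  | 0 => []
  | n + 1 => s :: altList t s n

/-- The braid relators `(sts⋯)(tst⋯)⁻¹` (`m_{s,t}` letters each) for `s ≠ t`,
`m_{s,t} ≠ ∞`. -/
def braidRels (M : CoxeterMatrix B) : Set (FreeGroup B) :=
  { r | ∃ s t : B, s ≠ t ∧ M s t ≠ 0 ∧
      r = ((altList s t (M s t)).map FreeGroup.of).prod *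
          (((altList t s (M s t)).map FreeGroup.of).prod)⁻¹ }

/-- The Artin-Tits group associated to the Coxeter matrix `M`. -/
def Artin (M : CoxeterMatrix B) : Type _ := PresentedGroup (braidRels M)

instance (M : CoxeterMatrix B) : Group (Artin M) :=
  QuotientGroup.Quotient.group _

/-- The standard generator of `Artin M` indexed by `s : B` (the image of `S` in `A_S`). -/
def gen (M : CoxeterMatrix B) (s : B) : Artin M := PresentedGroup.of s

theorem altList_eq_reverse_alternatingWord (s t : B) (n : ℕ) :
    altList s t n = (CoxeterSystem.alternatingWord t s n).reverse := by
  induction n generalizing s t with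
  | zero => rfl
  | succ n ih =>
      rw [altList, CoxeterSystem.alternatingWord_succ, List.concat_eq_append,
        List.reverse_append]
      simp [ih]

theorem lift_simple_listProd (M : CoxeterMatrix B) (l : List B) :
    FreeGroup.lift M.simple ((l.map FreeGroup.of).prod) =
      M.toCoxeterSystem.wordProd l := by
  rw [CoxeterSystem.wordProd, map_list_prod, List.map_map]
  simp [Function.comp_def, CoxeterMatrix.toCoxeterSystem_simple]

theorem braid_lift (M : CoxeterMatrix B) :
    ∀ r ∈ braidRels M, FreeGroup.lift M.simple r = 1 := by
  rintro r ⟨s, t, hst, hm, rfl⟩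
  rw [map_mul, map_inv, lift_simple_listProd, lift_simple_listProd,
    altList_eq_reverse_alternatingWord, altList_eq_reverse_alternatingWord,
    CoxeterSystem.wordProd_reverse, CoxeterSystem.wordProd_reverse]
  have hsym : M s t = M t s := M.symmetric s t
  have hb := M.toCoxeterSystem.wordProd_braidWord_eq t s
  rw [CoxeterSystem.braidWord, CoxeterSystem.braidWord, ← hsym] at hb
  rw [hb]
  simp

/-- The canonical projection from the Artin-Tits group onto the Coxeter group
(adding the relations `s² = 1`). -/
def proj (M : CoxeterMatrix B) : Artin M →* M.Group :=
  PresentedGroup.toGroup (braid_lift M)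

/-- The positive monoid `A_S⁺`, the submonoid of `A_S` generated by `S`. -/
def posMon (M : CoxeterMatrix B) : Submonoid (Artin M) :=
  Submonoid.closure (Set.range (gen M))

/-- The submonoid `A_X⁺` of `A_S` generated by `X ⊆ S`. -/
def posMonOn (M : CoxeterMatrix B) (X : Set B) : Submonoid (Artin M) :=
  Submonoid.closure (gen M '' X)

/-- The standard parabolic subgroup `A_X` of `A_S` generated by `X ⊆ S`. -/
def stdSub (M : CoxeterMatrix B) (X : Set B) : Subgroup (Artin M) :=
  Subgroup.closure (gen M '' X)

/-- The standard parabolic subgroup `W_X` of the Coxeter group `W_S`. -/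
def coxSub (M : CoxeterMatrix B) (X : Set B) : Subgroup M.Group :=
  Subgroup.closure (M.simple '' X)

/-- `X ⊆ S` is of spherical type if the Coxeter group `W_X` is finite. -/
def IsSpherical (M : CoxeterMatrix B) (X : Set B) : Prop :=
  Finite (coxSub M X)

/-- `a` left-divides `b` in the positive monoid: `b = a c` with `c ∈ A_S⁺`. -/
def ldvd (M : CoxeterMatrix B) (a b : Artin M) : Prop :=
  ∃ c ∈ posMon M, a * c = b

/-- `a` right-divides `b` in the positive monoid: `b = c a` with `c ∈ A_S⁺`. -/
def rdvd (M : CoxeterMatrix B) (a b : Artin M) : Prop :=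
  ∃ c ∈ posMon M, c * a = b

/-- `d` is the least common multiple `Δ_X` of `X` in `A_X⁺` (for left-divisibility). -/
def IsDelta (M : CoxeterMatrix B) (X : Set B) (d : Artin M) : Prop :=
  d ∈ posMonOn M X ∧
  (∀ s ∈ X, ∃ c ∈ posMonOn M X, gen M s * c = d) ∧
  ∀ m ∈ posMonOn M X, (∀ s ∈ X, ∃ c ∈ posMonOn M X, gen M s * c = m) →
    ∃ c ∈ posMonOn M X, d * c = m

/-- The subset `Xg = {σ_x g : x ∈ X}` of `A_S`. -/
def leftMul (M : CoxeterMatrix B) (X : Set B) (g : Artin M) : Set (Artin M) :=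
  (fun x => gen M x * g) '' X

/-- The subset `gX = {g σ_x : x ∈ X}` of `A_S`. -/
def rightMul (M : CoxeterMatrix B) (X : Set B) (g : Artin M) : Set (Artin M) :=
  (fun x => g * gen M x) '' X

/-- `Conj(S;X,Y) = {g ∈ A_S : gX = Yg}`. -/
def conjSet (M : CoxeterMatrix B) (X Y : Set B) : Set (Artin M) :=
  { g | rightMul M X g = leftMul M Y g }

/-- `Conj⁺(S;X,Y) = {g ∈ A_S⁺ : gX = Yg}`. -/
def conjPos (M : CoxeterMatrix B) (X Y : Set B) : Set (Artin M) :=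
  { g | g ∈ posMon M ∧ rightMul M X g = leftMul M Y g }

/-- The quasi-centralizer `QZ_{A_S}(A_X) = {g ∈ A_S : gX = Xg}`. -/
def QZset (M : CoxeterMatrix B) (X : Set B) : Set (Artin M) :=
  conjSet M X X

/-- The indecomposable component of `Z` containing `t` (vertices of `Z` joined to `t`
by a path of edges `m_{a,b} ≠ 2` in the Coxeter diagram on `Z`). -/
def comp (M : CoxeterMatrix B) (Z : Set B) (t : B) : Set B :=
  { s ∈ Z | Relation.ReflTransGen (fun a b => a ∈ Z ∧ b ∈ Z ∧ a ≠ b ∧ M a b ≠ 2) t s }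

/-- `Z` is indecomposable: it admits no nontrivial partition `Z = Z₁ ∪ Z₂` with
`m_{a,b} = 2` for `a ∈ Z₁`, `b ∈ Z₂`. -/
def Indecomp (M : CoxeterMatrix B) (Z : Set B) : Prop :=
  ¬ ∃ Z₁ Z₂ : Set B, Z₁.Nonempty ∧ Z₂.Nonempty ∧ Z₁ ∪ Z₂ = Z ∧ Disjoint Z₁ Z₂ ∧
      ∀ a ∈ Z₁, ∀ b ∈ Z₂, M a b = 2

/-- `g` is an elementary positive `Y`-ribbon-`X`: `g = d_{X,t}` for some `t ∈ S` with
`X(t)` of spherical type, where `d_{X,t} = Δ_{X(t)}` if `t ∈ X` and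
`d_{X,t} = Δ_{X(t)} Δ_{X(t)∖{t}}⁻¹` otherwise, and `Y ⊆ X ∪ {t}` satisfies `Yg = gX`. -/
def IsElemRibbon (M : CoxeterMatrix B) (X Y : Set B) (g : Artin M) : Prop :=
  ∃ t : B, IsSpherical M (comp M (X ∪ {t}) t) ∧
    ((t ∈ X ∧ IsDelta M (comp M (X ∪ {t}) t) g) ∨
      (t ∉ X ∧ ∃ d₁ d₂ : Artin M, IsDelta M (comp M (X ∪ {t}) t) d₁ ∧
        IsDelta M ((comp M (X ∪ {t}) t) \ {t}) d₂ ∧ g = d₁ * d₂⁻¹)) ∧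
    Y ⊆ X ∪ {t} ∧ leftMul M Y g = rightMul M X g

/-- `g` is a positive `Y`-ribbon-`X`: a product `g = g_n ⋯ g_1` of elementary positive
`X_i`-ribbons-`X_{i-1}` with `X_0 = X`, `X_n = Y`. -/
inductive IsRibbon (M : CoxeterMatrix B) : Set B → Set B → Artin M → Prop
  | nil (X : Set B) : IsRibbon M X X 1
  | cons {X Y Z : Set B} {g h : Artin M} :
      IsRibbon M X Y g → IsElemRibbon M Y Z h → IsRibbon M X Z (h * g)

/-- `g` is `X`-reduced: no element of `X` left-divides `g`. -/
def lreduced (M : CoxeterMatrix B) (X : Set B) (g : Artin M) : Prop :=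
  ∀ s ∈ X, ¬ ldvd M (gen M s) g

/-- `g` is reduced-`X`: no element of `X` right-divides `g`. -/
def rreduced (M : CoxeterMatrix B) (X : Set B) (g : Artin M) : Prop :=
  ∀ s ∈ X, ¬ rdvd M (gen M s) g

/-- The set `H_X` of elements `g₁ g₂⁻¹` where `g₁, g₂` are `X`-reduced positive
`X`-ribbons-`X`. -/
def HXset (M : CoxeterMatrix B) (X : Set B) : Set (Artin M) :=
  { g | ∃ g₁ g₂ : Artin M, IsRibbon M X X g₁ ∧ lreduced M X g₁ ∧
      IsRibbon M X X g₂ ∧ lreduced M X g₂ ∧ g = g₁ * g₂⁻¹ }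

/-- The length of a positive element (the common length of its expressions as words
in the generators; junk value `0` outside of `A_S⁺`). -/
noncomputable def len (M : CoxeterMatrix B) (g : Artin M) : ℕ :=
  sInf { n | ∃ l : List B, l.length = n ∧ (l.map (gen M)).prod = g }

/-- The length of an element of the Coxeter group `W_S`. -/
noncomputable def wlen (M : CoxeterMatrix B) (w : M.Group) : ℕ :=
  sInf { n | ∃ l : List B, l.length = n ∧ (l.map M.simple).prod = w }

/-- `g ∈ A_{S,red}`: `g` is positive and has the same length as its image in `W_S`. -/
def Red (M : CoxeterMatrix B) (g : Artin M) : Prop :=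
  g ∈ posMon M ∧ len M g = wlen M (proj M g)

/-- `C` is a simple `s`-chain-`u`: either `C = 1` and `s = u`, or
`C = tst⋯` (`k` letters, `k < m_{s,t}`) with `u ∈ {s,t}` and `C·u = tst⋯` (`k+1` letters). -/
def IsSimpleChain (M : CoxeterMatrix B) (s u : B) (C : Artin M) : Prop :=
  (C = 1 ∧ s = u) ∨
  ∃ t : B, t ≠ s ∧ (u = s ∨ u = t) ∧ ∃ k : ℕ,
    (M s t = 0 ∨ k < M s t) ∧
    C = ((altList t s k).map (gen M)).prod ∧
    C * gen M u = ((altList t s (k + 1)).map (gen M)).prod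

/-- `C` is an `s`-chain-`t`: a product `C₁ ⋯ C_k` of simple chains composing from
origin `s` to target `t`. -/
inductive IsChain (M : CoxeterMatrix B) : B → B → Artin M → Prop
  | single {s u : B} {C : Artin M} : IsSimpleChain M s u C → IsChain M s u C
  | comp {s u v : B} {C D : Artin M} :
      IsChain M s u C → IsSimpleChain M u v D → IsChain M s v (C * D)


/-- The coefficient `(e_s, e_t)` of the canonical bilinear form of the root basis:
`-cos (π / m_{s,t})`, with the value `-1` if `m_{s,t} = ∞` (encoded by `0`). -/
noncomputable def formCoeff (M : CoxeterMatrix B) (s t : B) : ℝ :=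
  if M s t = 0 then -1 else -Real.cos (Real.pi / (M s t : ℝ))

/-- The canonical symmetric bilinear form on `E = B → ℝ`. -/
noncomputable def bform [Fintype B] (M : CoxeterMatrix B) (u v : B → ℝ) : ℝ :=
  ∑ s : B, ∑ t : B, u s * v t * formCoeff M s t

/-- The simple root `e_s` in `E = B → ℝ`. -/
def esimple [DecidableEq B] (s : B) : B → ℝ := Pi.single s 1

/-! ### The bilinear form and the geometric representation -/

section Coxeter

variable {B : Type*} (M : CoxeterMatrix B)

/-- The length function of the Coxeter group. -/
noncomputable def wl (w : M.Group) : ℕ := M.toCoxeterSystem.length w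

/-- The element of the Coxeter group spelled by a word. -/
def wp (l : List B) : M.Group := (l.map M.simple).prod

variable {M}

@[simp] theorem wp_nil : wp M [] = 1 := rfl

@[simp] theorem wp_cons (s : B) (l : List B) : wp M (s :: l) = M.simple s * wp M l := by
  simp [wp]

theorem wp_append (l l' : List B) : wp M (l ++ l') = wp M l * wp M l' := by
  simp [wp]

theorem simple_mul_self (s : B) : M.simple s * M.simple s = 1 :=
  M.toCoxeterSystem.simple_mul_simple_self s

theorem simple_mul_cancel (s : B) (w : M.Group) : M.simple s * (M.simple s * w) = w :=
  M.toCoxeterSystem.simple_mul_simple_cancel_left s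

theorem mul_simple_cancel (s : B) (w : M.Group) : w * M.simple s * M.simple s = w :=
  M.toCoxeterSystem.simple_mul_simple_cancel_right s

theorem simple_inv (s : B) : (M.simple s)⁻¹ = M.simple s :=
  M.toCoxeterSystem.inv_simple s

theorem wl_one : wl M 1 = 0 := M.toCoxeterSystem.length_one

theorem wl_eq_zero {w : M.Group} : wl M w = 0 ↔ w = 1 := M.toCoxeterSystem.length_eq_zero_iff

theorem wl_inv (w : M.Group) : wl M w⁻¹ = wl M w := M.toCoxeterSystem.length_inv w

theorem wl_mul_le (u v : M.Group) : wl M (u * v) ≤ wl M u + wl M v :=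
  M.toCoxeterSystem.length_mul_le u v

theorem wl_wp_le (l : List B) : wl M (wp M l) ≤ l.length :=
  M.toCoxeterSystem.length_wordProd_le l

theorem wl_simple (s : B) : wl M (M.simple s) = 1 := M.toCoxeterSystem.length_simple s

theorem wl_eq_one {w : M.Group} : wl M w = 1 ↔ ∃ s, w = M.simple s :=
  M.toCoxeterSystem.length_eq_one_iff

theorem wl_simple_mul (s : B) (w : M.Group) :
    wl M (M.simple s * w) = wl M w + 1 ∨ wl M (M.simple s * w) + 1 = wl M w :=
  M.toCoxeterSystem.length_simple_mul w s

theorem wl_mul_simple (s : B) (w : M.Group) :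
    wl M (w * M.simple s) = wl M w + 1 ∨ wl M (w * M.simple s) + 1 = wl M w :=
  M.toCoxeterSystem.length_mul_simple w s

theorem exists_left_descent {w : M.Group} (h : w ≠ 1) :
    ∃ s, wl M (M.simple s * w) < wl M w :=
  M.toCoxeterSystem.exists_leftDescent_of_ne_one h

theorem exists_right_descent {w : M.Group} (h : w ≠ 1) :
    ∃ s, wl M (w * M.simple s) < wl M w :=
  M.toCoxeterSystem.exists_rightDescent_of_ne_one h

theorem wp_altList_symm (s t : B) : wp M (altList s t (M s t)) = wp M (altList t s (M s t)) := by
  have h := M.toCoxeterSystem.wordProd_braidWord_eq s t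
  have key : ∀ (a b : B) (n : ℕ), wp M (altList a b n) =
      (M.toCoxeterSystem.wordProd (CoxeterSystem.alternatingWord b a n))⁻¹ := by
    intro a b n
    rw [← CoxeterSystem.wordProd_reverse, ← altList_eq_reverse_alternatingWord]
    rfl
  rw [CoxeterSystem.braidWord, CoxeterSystem.braidWord, M.symmetric t s] at h
  rw [key, key, h]

@[simp] theorem altList_length (s t : B) (n : ℕ) : (altList s t n).length = n := by
  induction n generalizing s t with
  | zero => rfl
  | succ n ih => simp [altList, ih]

theorem altList_succ (s t : B) (n : ℕ) :
    altList s t (n + 1) = altList s t n ++ [if Even n then s else t] := by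
  induction n generalizing s t with
  | zero => simp [altList]
  | succ n ih =>
    rw [altList, ih, altList]
    by_cases h : Even n <;> simp [h, Nat.even_add_one]

theorem formCoeff_symm (s t : B) : formCoeff M s t = formCoeff M t s := by
  simp [formCoeff, M.symmetric s t]

theorem formCoeff_self (s : B) : formCoeff M s s = 1 := by
  simp [formCoeff]

theorem wl_simple_mul_inv (s : B) (w : M.Group) :
    wl M (M.simple s * w⁻¹) = wl M (w * M.simple s) := by
  rw [← wl_inv, mul_inv_rev, simple_inv, inv_inv]

variable [Fintype B]

theorem bform_symm (u v : B → ℝ) : bform M u v = bform M v u := by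
  unfold bform
  rw [Finset.sum_comm]
  refine Finset.sum_congr rfl fun s _ => Finset.sum_congr rfl fun t _ => ?_
  rw [formCoeff_symm, mul_comm (u t)]

theorem bform_sub_left (u v w : B → ℝ) : bform M (u - v) w = bform M u w - bform M v w := by
  simp [bform, sub_mul, Finset.sum_sub_distrib]

theorem bform_smul_left (c : ℝ) (u w : B → ℝ) : bform M (c • u) w = c * bform M u w := by
  simp [bform, Finset.mul_sum, mul_assoc]

theorem bform_sub_right (u v w : B → ℝ) : bform M w (u - v) = bform M w u - bform M w v := by
  rw [bform_symm, bform_sub_left, bform_symm u, bform_symm v]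

theorem bform_smul_right (c : ℝ) (u w : B → ℝ) : bform M w (c • u) = c * bform M w u := by
  rw [bform_symm, bform_smul_left, bform_symm u]

variable [DecidableEq B]

theorem bform_esimple (s t : B) : bform M (esimple s) (esimple t) = formCoeff M s t := by
  simp [bform, esimple, Pi.single_apply]

theorem bform_esimple_self (s : B) : bform M (esimple s) (esimple s) = 1 := by
  rw [bform_esimple, formCoeff_self]

omit [Fintype B] [DecidableEq B] in
/-- The coefficients of the dihedral roots in the two simple roots. -/
theorem exists_dihedral_coeff {s t : B} (hst : s ≠ t) :
    ∃ p : ℕ → ℝ, p 0 = 0 ∧ p 1 = 1 ∧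
      (∀ n, p (n + 2) = -2 * formCoeff M s t * p (n + 1) - p n) ∧
      ∀ n, (M s t = 0 ∨ n ≤ M s t) → 0 ≤ p n := by
  by_cases h0 : M s t = 0
  · refine ⟨fun n => n, by simp, by simp, fun n => ?_, fun n _ => Nat.cast_nonneg n⟩
    simp only [formCoeff, h0, if_true]
    push_cast
    ring
  · have h2 : 2 ≤ M s t := by
      have := M.off_diagonal s t hst
      change M s t ≠ 1 at this
      omega
    have h2' : (2 : ℝ) ≤ M s t := by exact_mod_cast h2
    set θ : ℝ := Real.pi / (M s t : ℝ) with hθ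
    have hθ0 : 0 < θ := by positivity
    have hθ1 : θ < Real.pi := by
      rw [hθ, div_lt_iff₀ (by linarith)]
      nlinarith [Real.pi_pos]
    have hs : 0 < Real.sin θ := Real.sin_pos_of_pos_of_lt_pi hθ0 hθ1
    refine ⟨fun n => Real.sin (n * θ) / Real.sin θ, by simp, by simp [hs.ne'], fun n => ?_,
      fun n hn => ?_⟩
    · simp only [formCoeff, h0, if_false, ← hθ]
      have e1 : ((n + 2 : ℕ) : ℝ) * θ = ((n + 1 : ℕ) : ℝ) * θ + θ := by push_cast; ring
      have e2 : (n : ℝ) * θ = ((n + 1 : ℕ) : ℝ) * θ - θ := by push_cast; ring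
      rw [e1, e2, Real.sin_add, Real.sin_sub]
      field_simp
      ring
    · have hn' : n ≤ M s t := hn.resolve_left h0
      have hn'' : (n : ℝ) ≤ M s t := by exact_mod_cast hn'
      refine div_nonneg (Real.sin_nonneg_of_nonneg_of_le_pi (by positivity) ?_) hs.le
      rw [hθ, mul_div_assoc', div_le_iff₀ (by linarith)]
      nlinarith [Real.pi_pos]

/-- `ρ` is the geometric representation of the Coxeter group. -/
def IsGeom (M : CoxeterMatrix B) (ρ : M.Group →* Module.End ℝ (B → ℝ)) : Prop :=
  ∀ (s : B) (v : B → ℝ), ρ (M.simple s) v = v - (2 * bform M v (esimple s)) • esimple s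

namespace IsGeom

variable {ρ : M.Group →* Module.End ℝ (B → ℝ)} (hρ : IsGeom M ρ)

omit [Fintype B] [DecidableEq B] in
theorem mul_apply (ρ : M.Group →* Module.End ℝ (B → ℝ)) (u v : M.Group) (x : B → ℝ) :
    ρ (u * v) x = ρ u (ρ v x) := by
  rw [map_mul]; rfl

omit [Fintype B] [DecidableEq B] in
theorem inv_apply_self (ρ : M.Group →* Module.End ℝ (B → ℝ)) (u : M.Group) (x : B → ℝ) :
    ρ u⁻¹ (ρ u x) = x := by
  rw [← mul_apply]; simp

omit [Fintype B] [DecidableEq B] in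
theorem apply_inv_self (ρ : M.Group →* Module.End ℝ (B → ℝ)) (u : M.Group) (x : B → ℝ) :
    ρ u (ρ u⁻¹ x) = x := by
  rw [← mul_apply]; simp

include hρ

theorem simple_self (s : B) : ρ (M.simple s) (esimple s) = -esimple s := by
  rw [hρ, bform_esimple_self]
  module

theorem simple_of_ne (s : B) (v : B → ℝ) (r : B) (h : r ≠ s) : ρ (M.simple s) v r = v r := by
  rw [hρ]; simp [esimple, h]

theorem bform_apply (w : M.Group) (u v : B → ℝ) : bform M (ρ w u) (ρ w v) = bform M u v := by
  induction w using M.toCoxeterSystem.simple_induction_left generalizing u v with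
  | one => simp
  | mul_simple_left w s ih =>
    change bform M (ρ (M.simple s * w) u) (ρ (M.simple s * w) v) = _
    rw [mul_apply, mul_apply, ← ih u v, hρ, hρ]
    simp only [bform_sub_left, bform_sub_right, bform_smul_left, bform_smul_right,
      bform_esimple_self, bform_symm (esimple s)]
    ring

theorem dihedral_nonneg {s t : B} (f : (B → ℝ) →ₗ[ℝ] (B → ℝ)) (p : ℕ → ℝ)
    (hp : ∀ n, p (n + 2) = -2 * formCoeff M s t * p (n + 1) - p n) (j k : ℕ)
    (hpos : ∀ n ≤ j + k + 1, 0 ≤ p n) (hs : 0 ≤ f (esimple s)) (ht : 0 ≤ f (esimple t)) :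
    0 ≤ f (ρ (wp M (altList t s k))⁻¹ (p (j + 1) • esimple s + p j • esimple t)) := by
  induction k generalizing s t j with
  | zero =>
    have h1 := hpos j (by omega)
    have h2 := hpos (j + 1) (by omega)
    simp only [altList, wp_nil, inv_one, map_one, Module.End.one_apply, map_add, map_smul]
    exact add_nonneg (smul_nonneg h2 hs) (smul_nonneg h1 ht)
  | succ k ih =>
    rw [altList, wp_cons, mul_inv_rev, mul_apply, simple_inv]
    have e : ρ (M.simple t) (p (j + 1) • esimple s + p j • esimple t) =
        p (j + 1 + 1) • esimple t + p (j + 1) • esimple s := by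
      rw [map_add, map_smul, map_smul, simple_self hρ, hρ, bform_esimple, hp]
      module
    rw [e]
    refine ih (s := t) (t := s) (by simpa only [formCoeff_symm t s] using hp) (j + 1)
      (fun n hn => hpos n (by omega)) ht hs

theorem braid_or_nonneg {s t : B} (hst : s ≠ t) (a : M.Group)
    (hta : wl M (M.simple t * a) < wl M a)
    (H : ∀ v r, wl M v < wl M a → wl M v < wl M (M.simple r * v) → 0 ≤ ρ v⁻¹ (esimple r)) :
    (M s t ≠ 0 ∧ ∃ v, a = wp M (altList t s (M s t)) * v ∧ wl M v + M s t = wl M a) ∨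
      0 ≤ ρ a⁻¹ (esimple s) := by
  classical
  set P : ℕ → Prop := fun k => ∃ v, a = wp M (altList t s k) * v ∧ wl M v + k = wl M a with hP
  have hdown : ∀ k, P (k + 1) → P k := by
    rintro k ⟨v, hv, hl⟩
    rw [altList_succ, wp_append, wp_cons, wp_nil, mul_one, mul_assoc] at hv
    refine ⟨_, hv, ?_⟩
    have h1 := wl_mul_le (wp M (altList t s k)) (M.simple (if Even k then t else s) * v)
    rw [← hv] at h1
    have h2 := wl_wp_le (M := M) (altList t s k)
    rw [altList_length] at h2
    have h3 := wl_simple_mul (if Even k then t else s) v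
    omega
  have hP1 : P 1 := by
    refine ⟨M.simple t * a, by simp [altList, simple_mul_cancel], ?_⟩
    have := wl_simple_mul t a
    omega
  have hex : ∃ k, ¬ P (k + 1) := by
    refine ⟨wl M a, ?_⟩
    rintro ⟨v, -, hl⟩
    omega
  set k := Nat.find hex with hk
  have hmax : ¬ P (k + 1) := Nat.find_spec hex
  have hle : ∀ j ≤ k, 0 < j → P j := by
    intro j hj h0
    obtain ⟨i, rfl⟩ := Nat.exists_eq_succ_of_ne_zero h0.ne'
    exact not_not.1 (Nat.find_min hex (m := i) (by omega))
  have hk1 : 1 ≤ k := by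
    by_contra h
    have : k = 0 := by omega
    rw [this] at hmax
    exact hmax hP1
  by_cases hm : M s t ≠ 0 ∧ M s t ≤ k
  · exact Or.inl ⟨hm.1, hle _ hm.2 (Nat.pos_of_ne_zero hm.1)⟩
  right
  obtain ⟨v, hv, hl⟩ := hle k le_rfl hk1
  have hva : wl M v < wl M a := by omega
  have hnext : wl M v < wl M (M.simple (if Even k then t else s) * v) := by
    by_contra hcon
    apply hmax
    refine ⟨M.simple (if Even k then t else s) * v, ?_, ?_⟩
    · rw [altList_succ, wp_append, wp_cons, wp_nil, mul_one, mul_assoc, simple_mul_cancel, ← hv]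
    · have h3 := wl_simple_mul (if Even k then t else s) v
      omega
  have hprev : wl M v < wl M (M.simple (if Even k then s else t) * v) := by
    by_contra hcon
    obtain ⟨j, hj⟩ : ∃ j, k = j + 1 := ⟨k - 1, by omega⟩
    rw [hj, altList_succ, wp_append, wp_cons, wp_nil, mul_one, mul_assoc] at hv
    have h1 := wl_mul_le (wp M (altList t s j)) (M.simple (if Even j then t else s) * v)
    rw [← hv] at h1
    have h2 := wl_wp_le (M := M) (altList t s j)
    rw [altList_length] at h2
    have e : (if Even k then s else t) = (if Even j then t else s) := by
      rw [hj]
      by_cases h : Even j <;> simp [h, Nat.even_add_one]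
    rw [e] at hcon
    have h3 := wl_simple_mul (if Even j then t else s) v
    omega
  have hs : 0 ≤ ρ v⁻¹ (esimple s) := by
    by_cases h : Even k
    · exact H v s hva (by simpa [h] using hprev)
    · exact H v s hva (by simpa [h] using hnext)
  have ht : 0 ≤ ρ v⁻¹ (esimple t) := by
    by_cases h : Even k
    · exact H v t hva (by simpa [h] using hnext)
    · exact H v t hva (by simpa [h] using hprev)
  obtain ⟨p, hp0, hp1, hp, hpn⟩ := exists_dihedral_coeff (M := M) hst
  have := dihedral_nonneg hρ (ρ v⁻¹) p hp 0 k (fun n hn => hpn n (by omega)) hs ht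
  rw [hv, mul_inv_rev, mul_apply]
  simpa [hp0, hp1] using this

theorem inv_nonneg (a : M.Group) (s : B) (h : wl M a < wl M (M.simple s * a)) :
    0 ≤ ρ a⁻¹ (esimple s) := by
  induction hn : wl M a using Nat.strong_induction_on generalizing a s with
  | _ n ih =>
    subst hn
    by_cases ha : a = 1
    · subst ha
      simp only [inv_one, map_one, Module.End.one_apply]
      exact Pi.single_nonneg.2 zero_le_one
    obtain ⟨t, ht⟩ := exists_left_descent ha
    have hst : s ≠ t := by rintro rfl; omega
    rcases braid_or_nonneg hρ hst a ht (fun v r hv hr => ih _ hv v r hr rfl) with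
      ⟨hm, v, hv, hl⟩ | h'
    · exfalso
      obtain ⟨m, hm'⟩ := Nat.exists_eq_succ_of_ne_zero hm
      rw [← wp_altList_symm, hm', altList, wp_cons, mul_assoc] at hv
      rw [hv, simple_mul_cancel, ← hv] at h
      have h1 := wl_mul_le (wp M (altList t s m)) v
      have h2 := wl_wp_le (M := M) (altList t s m)
      rw [altList_length] at h2
      omega
    · exact h'

theorem nonneg_of_lt {w : M.Group} {s : B} (h : wl M w < wl M (w * M.simple s)) :
    0 ≤ ρ w (esimple s) := by
  have := inv_nonneg hρ w⁻¹ s (by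
    rwa [wl_inv, wl_simple_mul_inv])
  rwa [inv_inv] at this

theorem nonpos_of_gt {w : M.Group} {s : B} (h : wl M (w * M.simple s) < wl M w) :
    ρ w (esimple s) ≤ 0 := by
  have := nonneg_of_lt hρ (w := w * M.simple s) (s := s) (by rwa [mul_simple_cancel])
  rw [mul_apply, simple_self hρ, map_neg] at this
  simpa using this

omit hρ [Fintype B] in
theorem esimple_ne_zero (s : B) : (esimple s : B → ℝ) ≠ 0 := by
  simp [esimple]

omit hρ [Fintype B] in
theorem apply_ne_zero (ρ : M.Group →* Module.End ℝ (B → ℝ)) (w : M.Group) (s : B) :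
    ρ w (esimple s) ≠ 0 := by
  intro h
  have := inv_apply_self ρ w (esimple s)
  rw [h, map_zero] at this
  exact esimple_ne_zero s this.symm

theorem lt_of_nonneg {w : M.Group} {s : B} (h : 0 ≤ ρ w (esimple s)) :
    wl M w < wl M (w * M.simple s) := by
  rcases wl_mul_simple s w with h1 | h1
  · omega
  · exact absurd (le_antisymm (nonpos_of_gt hρ (by omega)) h) (apply_ne_zero ρ w s)

theorem gt_of_nonpos {w : M.Group} {s : B} (h : ρ w (esimple s) ≤ 0) :
    wl M (w * M.simple s) < wl M w := by
  rcases wl_mul_simple s w with h1 | h1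
  · exact absurd (le_antisymm h (nonneg_of_lt hρ (by omega))) (apply_ne_zero ρ w s)
  · omega

theorem nonneg_or_nonpos (w : M.Group) (s : B) :
    0 ≤ ρ w (esimple s) ∨ ρ w (esimple s) ≤ 0 := by
  rcases wl_mul_simple s w with h1 | h1
  · exact Or.inl (nonneg_of_lt hρ (by omega))
  · exact Or.inr (nonpos_of_gt hρ (by omega))

/-- If `s` and `t` are left descents of `a`, then so is the longest element of the dihedral
group they generate. -/
theorem exists_braid_of_descents {s t : B} (hst : s ≠ t) {a : M.Group}
    (hs : wl M (M.simple s * a) < wl M a) (ht : wl M (M.simple t * a) < wl M a) :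
    M s t ≠ 0 ∧ ∃ v, a = wp M (altList t s (M s t)) * v ∧ wl M v + M s t = wl M a := by
  rcases braid_or_nonneg hρ hst a ht (fun v r _ hr => inv_nonneg hρ v r hr) with h | h
  · exact h
  · have := lt_of_nonneg hρ h
    rw [← wl_simple_mul_inv, inv_inv, wl_inv] at this
    omega

end IsGeom

end Coxeter

/-! ### The weak order -/

section WeakOrder

variable {B : Type*} {M : CoxeterMatrix B}

/-- `x` is a prefix of `a` for the weak order of the Coxeter group. -/
def Pre (x a : M.Group) : Prop := wl M x + wl M (x⁻¹ * a) = wl M a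

theorem wl_le_add_inv_mul (x a : M.Group) : wl M a ≤ wl M x + wl M (x⁻¹ * a) := by
  simpa using wl_mul_le x (x⁻¹ * a)

theorem Pre.refl (x : M.Group) : Pre x x := by simp [Pre, wl_one]

theorem Pre.one (x : M.Group) : Pre 1 x := by simp [Pre, wl_one]

theorem Pre.trans {x y a : M.Group} (h : Pre x y) (h' : Pre y a) : Pre x a := by
  unfold Pre at *
  have h1 := wl_mul_le (x⁻¹ * y) (y⁻¹ * a)
  have h2 := wl_le_add_inv_mul x a
  have e : x⁻¹ * y * (y⁻¹ * a) = x⁻¹ * a := by group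
  rw [e] at h1
  omega

theorem Pre.wl_le {x a : M.Group} (h : Pre x a) : wl M x ≤ wl M a := by
  unfold Pre at h; omega

theorem Pre.eq_of_wl_le {x a : M.Group} (h : Pre x a) (hl : wl M a ≤ wl M x) : x = a := by
  unfold Pre at h
  have : wl M (x⁻¹ * a) = 0 := by omega
  exact inv_mul_eq_one.1 (wl_eq_zero.1 this)

theorem Pre.antisymm {x y : M.Group} (h : Pre x y) (h' : Pre y x) : x = y :=
  h.eq_of_wl_le h'.wl_le

theorem pre_mul {x y : M.Group} (h : wl M (x * y) = wl M x + wl M y) : Pre x (x * y) := by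
  simp [Pre, h]

theorem pre_simple {s : B} {a : M.Group} :
    Pre (M.simple s) a ↔ wl M (M.simple s * a) < wl M a := by
  unfold Pre
  rw [simple_inv, wl_simple]
  have := wl_simple_mul s a
  omega

theorem pre_mul_left_iff {u x v : M.Group} (hx : wl M (u * x) = wl M u + wl M x)
    (hv : wl M (u * v) = wl M u + wl M v) : Pre (u * x) (u * v) ↔ Pre x v := by
  unfold Pre
  have e : (u * x)⁻¹ * (u * v) = x⁻¹ * v := by group
  rw [e]
  omega

theorem Pre.add_of_add {u x v : M.Group} (h : Pre x v) (hv : wl M (u * v) = wl M u + wl M v) :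
    wl M (u * x) = wl M u + wl M x := by
  unfold Pre at h
  have h1 := wl_mul_le (u * x) (x⁻¹ * v)
  have e : u * x * (x⁻¹ * v) = u * v := by group
  rw [e] at h1
  have := wl_mul_le u x
  omega

theorem pre_simple_mul_iff {s : B} {x v : M.Group} (hx : Pre (M.simple s) x)
    (hv : Pre (M.simple s) v) : Pre (M.simple s * x) (M.simple s * v) ↔ Pre x v := by
  rw [pre_simple] at hx hv
  have h1 := wl_simple_mul s x
  have h2 := wl_simple_mul s v
  have := pre_mul_left_iff (u := M.simple s) (x := M.simple s * x) (v := M.simple s * v)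
    (by rw [simple_mul_cancel, wl_simple]; omega) (by rw [simple_mul_cancel, wl_simple]; omega)
  rw [simple_mul_cancel, simple_mul_cancel] at this
  exact this.symm

variable [Fintype B] [DecidableEq B] {ρ : M.Group →* Module.End ℝ (B → ℝ)}

theorem IsGeom.exists_common_prefix_of_simple (hρ : IsGeom M ρ) {s t : B} {a b : M.Group}
    (hsa : Pre (M.simple s) a) (hta : Pre (M.simple t) a) (hsb : Pre (M.simple s) b)
    (htb : Pre (M.simple t) b) :
    ∃ J, Pre J a ∧ Pre J b ∧ Pre (M.simple s) J ∧ Pre (M.simple t) J := by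
  by_cases hst : s = t
  · subst hst
    exact ⟨_, hsa, hsb, Pre.refl _, Pre.refl _⟩
  rw [pre_simple] at hsa hta hsb htb
  obtain ⟨hm, v, hv, hl⟩ := hρ.exists_braid_of_descents hst hsa hta
  obtain ⟨-, v', hv', hl'⟩ := hρ.exists_braid_of_descents hst hsb htb
  have hJ1 := wl_wp_le (M := M) (altList s t (M s t))
  have hsymm := wp_altList_symm (M := M) s t
  rw [← hsymm] at hv hv'
  have hJ2 := wl_mul_le (wp M (altList s t (M s t))) v
  rw [← hv] at hJ2
  rw [altList_length] at hJ1
  have hdesc : ∀ x y : B, wp M (altList x y (M s t)) = wp M (altList s t (M s t)) →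
      Pre (M.simple x) (wp M (altList s t (M s t))) := by
    intro x y h
    obtain ⟨m, hm'⟩ := Nat.exists_eq_succ_of_ne_zero hm
    rw [pre_simple, ← h]
    have h3 := wl_wp_le (M := M) (altList y x m)
    rw [altList_length] at h3
    have h4 : M.simple x * wp M (altList x y (M s t)) = wp M (altList y x m) := by
      rw [hm', altList, wp_cons, simple_mul_cancel]
    rw [h4, h]
    omega
  refine ⟨wp M (altList s t (M s t)), ?_, ?_, hdesc s t rfl, hdesc t s hsymm.symm⟩
  · have e : (wp M (altList s t (M s t)))⁻¹ * a = v := inv_mul_eq_iff_eq_mul.2 hv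
    rw [Pre, e]
    omega
  · have e : (wp M (altList s t (M s t)))⁻¹ * b = v' := inv_mul_eq_iff_eq_mul.2 hv'
    rw [Pre, e]
    omega

/-- Common prefixes of two elements form a directed set. -/
theorem IsGeom.exists_common_prefix (hρ : IsGeom M ρ) {a b x y : M.Group} (hxa : Pre x a)
    (hxb : Pre x b) (hya : Pre y a) (hyb : Pre y b) :
    ∃ z, Pre z a ∧ Pre z b ∧ Pre x z ∧ Pre y z := by
  induction hn : wl M a using Nat.strong_induction_on generalizing a b x y with
  | _ n ih =>
    subst hn
    have step : ∀ (s : B) (x y : M.Group), Pre (M.simple s) x → Pre (M.simple s) y → Pre x a →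
        Pre x b → Pre y a → Pre y b → ∃ z, Pre z a ∧ Pre z b ∧ Pre x z ∧ Pre y z := by
      intro s x y hsx hsy hxa hxb hya hyb
      have hsa := hsx.trans hxa
      have hsb := hsx.trans hxb
      have hlt := pre_simple.1 hsa
      obtain ⟨z, hza, hzb, hxz, hyz⟩ := ih _ hlt ((pre_simple_mul_iff hsx hsa).2 hxa)
        ((pre_simple_mul_iff hsx hsb).2 hxb) ((pre_simple_mul_iff hsy hsa).2 hya)
        ((pre_simple_mul_iff hsy hsb).2 hyb) rfl
      have hz : wl M (M.simple s * z) = wl M (M.simple s) + wl M z := by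
        refine hza.add_of_add ?_
        rw [simple_mul_cancel, wl_simple]
        have := wl_simple_mul s a
        omega
      have hsz := pre_mul hz
      refine ⟨M.simple s * z, ?_, ?_, ?_, ?_⟩
      · exact (pre_simple_mul_iff hsz hsa).1 (by rwa [simple_mul_cancel])
      · exact (pre_simple_mul_iff hsz hsb).1 (by rwa [simple_mul_cancel])
      · exact (pre_simple_mul_iff hsx hsz).1 (by rwa [simple_mul_cancel])
      · exact (pre_simple_mul_iff hsy hsz).1 (by rwa [simple_mul_cancel])
    by_cases hx : x = 1
    · exact ⟨y, hya, hyb, hx ▸ Pre.one y, Pre.refl y⟩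
    by_cases hy : y = 1
    · exact ⟨x, hxa, hxb, Pre.refl x, hy ▸ Pre.one x⟩
    obtain ⟨s, hs⟩ := exists_left_descent hx
    obtain ⟨t, ht⟩ := exists_left_descent hy
    rw [← pre_simple] at hs ht
    obtain ⟨J, hJa, hJb, hsJ, htJ⟩ := hρ.exists_common_prefix_of_simple (hs.trans hxa)
      (ht.trans hya) (hs.trans hxb) (ht.trans hyb)
    obtain ⟨z₁, h1a, h1b, hxz₁, hJz₁⟩ := step s x J hs hsJ hxa hxb hJa hJb
    obtain ⟨z₂, h2a, h2b, hyz₂, hJz₂⟩ := step t y J ht htJ hya hyb hJa hJb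
    obtain ⟨z, hza, hzb, hz₁, hz₂⟩ := step s z₁ z₂ (hsJ.trans hJz₁) (hsJ.trans hJz₂) h1a h1b h2a h2b
    exact ⟨z, hza, hzb, hxz₁.trans hz₁, hyz₂.trans hz₂⟩

/-- The weak order is a meet-semilattice. -/
theorem IsGeom.exists_meet (hρ : IsGeom M ρ) (a b : M.Group) :
    ∃ g, Pre g a ∧ Pre g b ∧ ∀ y, Pre y a → Pre y b → Pre y g := by
  classical
  set Q : ℕ → Prop := fun n => ∃ g, Pre g a ∧ Pre g b ∧ wl M g = n with hQ
  have h0 : Q 0 := ⟨1, Pre.one a, Pre.one b, wl_one⟩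
  obtain ⟨g, hga, hgb, hg⟩ := Nat.findGreatest_spec (P := Q) (Nat.zero_le (wl M a)) h0
  refine ⟨g, hga, hgb, fun y hya hyb => ?_⟩
  obtain ⟨z, hza, hzb, hgz, hyz⟩ := hρ.exists_common_prefix hga hgb hya hyb
  have := Nat.le_findGreatest (P := Q) hza.wl_le ⟨z, hza, hzb, rfl⟩
  rw [hgz.eq_of_wl_le (by omega)]
  exact hyz

end WeakOrder

/-! ### Parabolic subgroups and their longest elements -/

section Parabolic

variable {B : Type*} {M : CoxeterMatrix B}

theorem simple_mem_coxSub {Z : Set B} {s : B} (hs : s ∈ Z) : M.simple s ∈ coxSub M Z :=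
  Subgroup.subset_closure ⟨s, hs, rfl⟩

theorem exists_longest [Finite M.Group] (Z : Set B) :
    ∃ w ∈ coxSub M Z, ∀ x ∈ coxSub M Z, wl M x ≤ wl M w := by
  obtain ⟨w, hw⟩ := Finite.exists_max fun x : coxSub M Z => wl M (x : M.Group)
  exact ⟨w, w.2, fun x hx => hw ⟨x, hx⟩⟩

variable (M) in
/-- A longest element of the parabolic subgroup `W_Z`. -/
noncomputable def longest [Finite M.Group] (Z : Set B) : M.Group :=
  Classical.choose (exists_longest (M := M) Z)

theorem longest_mem [Finite M.Group] (Z : Set B) : longest M Z ∈ coxSub M Z :=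
  (Classical.choose_spec (exists_longest (M := M) Z)).1

theorem wl_le_longest [Finite M.Group] {Z : Set B} {x : M.Group} (hx : x ∈ coxSub M Z) :
    wl M x ≤ wl M (longest M Z) :=
  (Classical.choose_spec (exists_longest (M := M) Z)).2 x hx

theorem coxSub_univ : coxSub M Set.univ = ⊤ := by
  rw [coxSub, Set.image_univ]
  exact M.toCoxeterSystem.subgroup_closure_range_simple

theorem longest_mul_simple [Finite M.Group] {Z : Set B} {s : B} (hs : s ∈ Z) :
    wl M (longest M Z * M.simple s) + 1 = wl M (longest M Z) := by
  have h1 := wl_le_longest (mul_mem (longest_mem Z) (simple_mem_coxSub (M := M) hs))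
  have h2 := wl_mul_simple s (longest M Z)
  omega

theorem simple_mul_longest [Finite M.Group] {Z : Set B} {s : B} (hs : s ∈ Z) :
    wl M (M.simple s * longest M Z) + 1 = wl M (longest M Z) := by
  have h1 := wl_le_longest (mul_mem (simple_mem_coxSub (M := M) hs) (longest_mem Z))
  have h2 := wl_simple_mul s (longest M Z)
  omega

variable [Fintype B] [DecidableEq B] {ρ : M.Group →* Module.End ℝ (B → ℝ)}

omit [DecidableEq B] in
theorem apply_nonneg_of_support [DecidableEq B] {Z : Set B} (f : (B → ℝ) →ₗ[ℝ] (B → ℝ))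
    (hf : ∀ s ∈ Z, 0 ≤ f (esimple s)) {u : B → ℝ} (hu : 0 ≤ u) (huZ : ∀ r ∉ Z, u r = 0) :
    0 ≤ f u := by
  have e : u = ∑ r, u r • esimple r := by
    conv_lhs => rw [← Finset.univ_sum_single u]
    refine Finset.sum_congr rfl fun r _ => ?_
    rw [esimple, ← Pi.single_smul, smul_eq_mul, mul_one]
  rw [e, map_sum]
  refine Finset.sum_nonneg fun r _ => ?_
  rw [map_smul]
  by_cases hr : r ∈ Z
  · exact smul_nonneg (hu r) (hf r hr)
  · simp [huZ r hr]

namespace IsGeom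

variable (hρ : IsGeom M ρ)
include hρ

theorem apply_eq_of_mem {Z : Set B} {x : M.Group} (hx : x ∈ coxSub M Z) (v : B → ℝ) {r : B}
    (hr : r ∉ Z) : ρ x v r = v r := by
  induction hx using Subgroup.closure_induction generalizing v with
  | mem x hx =>
    obtain ⟨s, hs, rfl⟩ := hx
    exact simple_of_ne hρ s v r (by rintro rfl; exact hr hs)
  | one => simp
  | mul x y _ _ hx hy => rw [mul_apply, hx, hy]
  | inv x _ hx => rw [← hx (ρ x⁻¹ v), apply_inv_self]

theorem mem_of_right_descent {Z : Set B} {x : M.Group} (hx : x ∈ coxSub M Z) {t : B}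
    (ht : wl M (x * M.simple t) < wl M x) : t ∈ Z := by
  by_contra hn
  have h1 := nonpos_of_gt hρ ht t
  rw [apply_eq_of_mem hρ hx _ hn] at h1
  simp [esimple] at h1
  linarith

theorem coxSub_induction {Z : Set B} {p : M.Group → Prop} (one : p 1)
    (mul : ∀ x ∈ coxSub M Z, ∀ s ∈ Z, wl M (x * M.simple s) = wl M x + 1 → p x →
      p (x * M.simple s)) {x : M.Group} (hx : x ∈ coxSub M Z) : p x := by
  induction hn : wl M x using Nat.strong_induction_on generalizing x with
  | _ n ih =>
    subst hn
    by_cases h1 : x = 1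
    · rwa [h1]
    obtain ⟨s, hs⟩ := exists_right_descent h1
    have hsZ := mem_of_right_descent hρ hx hs
    have hmem := mul_mem hx (simple_mem_coxSub (M := M) hsZ)
    have := mul _ hmem s hsZ (by
      rw [mul_simple_cancel]
      have := wl_mul_simple s x
      omega) (ih _ hs hmem rfl)
    rwa [mul_simple_cancel] at this

theorem wl_mul_of_nonneg {Z : Set B} {v : M.Group} (hv : ∀ s ∈ Z, 0 ≤ ρ v (esimple s))
    {x : M.Group} (hx : x ∈ coxSub M Z) : wl M (v * x) = wl M v + wl M x := by
  refine coxSub_induction hρ (p := fun x => wl M (v * x) = wl M v + wl M x)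
    (by simp [wl_one]) (fun x hx s hs hlt ih => ?_) hx
  have h1 : 0 ≤ ρ x (esimple s) := nonneg_of_lt hρ (by omega)
  have h2 : 0 ≤ ρ v (ρ x (esimple s)) := by
    refine apply_nonneg_of_support (ρ v) hv h1 fun r hr => ?_
    rw [apply_eq_of_mem hρ hx _ hr]
    have : r ≠ s := by rintro rfl; exact hr hs
    simp [esimple, this]
  rw [← mul_apply] at h2
  have h3 := lt_of_nonneg hρ h2
  have h4 := wl_mul_simple s (v * x)
  rw [← mul_assoc]
  omega

theorem wl_mul_of_nonpos {Z : Set B} {v : M.Group} (hv : ∀ s ∈ Z, ρ v (esimple s) ≤ 0)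
    {x : M.Group} (hx : x ∈ coxSub M Z) : wl M (v * x) + wl M x = wl M v := by
  refine coxSub_induction hρ (p := fun x => wl M (v * x) + wl M x = wl M v)
    (by simp [wl_one]) (fun x hx s hs hlt ih => ?_) hx
  have h1 : 0 ≤ ρ x (esimple s) := nonneg_of_lt hρ (by omega)
  have h2 : 0 ≤ (-ρ v) (ρ x (esimple s)) := by
    refine apply_nonneg_of_support (Z := Z) (-ρ v) (fun r hr => ?_) h1 fun r hr => ?_
    · simpa using hv r hr
    · rw [apply_eq_of_mem hρ hx _ hr]
      have : r ≠ s := by rintro rfl; exact hr hs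
      simp [esimple, this]
  rw [LinearMap.neg_apply, ← mul_apply] at h2
  have h3 := gt_of_nonpos hρ (neg_nonneg.1 h2)
  have h4 := wl_mul_simple s (v * x)
  rw [← mul_assoc]
  omega

theorem wl_mul_of_right_descents {Z : Set B} {v : M.Group}
    (hv : ∀ s ∈ Z, wl M (v * M.simple s) < wl M v) {x : M.Group} (hx : x ∈ coxSub M Z) :
    wl M (v * x) + wl M x = wl M v :=
  wl_mul_of_nonpos hρ (fun s hs => nonpos_of_gt hρ (hv s hs)) hx

theorem wl_inv_mul_of_left_descents {Z : Set B} {v : M.Group}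
    (hv : ∀ s ∈ Z, Pre (M.simple s) v) {x : M.Group} (hx : x ∈ coxSub M Z) :
    wl M (v⁻¹ * x) + wl M x = wl M v := by
  rw [← wl_inv v]
  refine wl_mul_of_right_descents hρ (fun s hs => ?_) hx
  rw [← wl_simple_mul_inv, inv_inv, wl_inv]
  exact pre_simple.1 (hv s hs)

variable [Finite M.Group]

theorem longest_pre {Z : Set B} {v : M.Group} (hv : ∀ s ∈ Z, Pre (M.simple s) v) :
    Pre (longest M Z) v := by
  have := wl_inv_mul_of_left_descents hρ hv (longest_mem Z)
  rw [← wl_inv (v⁻¹ * _), mul_inv_rev, inv_inv] at this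
  unfold Pre
  omega

omit [Fintype B] [DecidableEq B] hρ in
theorem simple_pre_longest {Z : Set B} {s : B} (hs : s ∈ Z) :
    Pre (M.simple s) (longest M Z) := by
  rw [pre_simple]
  have := simple_mul_longest (M := M) hs
  omega

theorem wl_add_iff (u x : M.Group) :
    wl M (u * x) = wl M u + wl M x ↔ Pre x (u⁻¹ * longest M Set.univ) := by
  have key : ∀ y : M.Group, wl M (y⁻¹ * longest M Set.univ) + wl M y =
      wl M (longest M Set.univ) := by
    intro y
    have hy : y ∈ coxSub M Set.univ := by rw [coxSub_univ]; trivial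
    have := wl_inv_mul_of_left_descents hρ (v := longest M Set.univ)
      (fun s hs => simple_pre_longest hs) hy
    rwa [← wl_inv (_ * y), mul_inv_rev, inv_inv] at this
  have h1 := key (u * x)
  have h2 := key u
  unfold Pre
  rw [← mul_assoc, ← mul_inv_rev]
  omega

end IsGeom

/-- `cap u v` is the largest prefix `x` of `v` such that `u x` is reduced. -/
structure IsCap (cap : M.Group → M.Group → M.Group) : Prop where
  pre : ∀ u v, Pre (cap u v) v
  add : ∀ u v, wl M (u * cap u v) = wl M u + wl M (cap u v)
  max : ∀ u v y, Pre y v → wl M (u * y) = wl M u + wl M y → Pre y (cap u v)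

theorem IsGeom.exists_cap [Finite M.Group] (hρ : IsGeom M ρ) :
    ∃ cap : M.Group → M.Group → M.Group, IsCap cap := by
  choose g h1 h2 h3 using fun u v : M.Group => hρ.exists_meet v (u⁻¹ * longest M Set.univ)
  exact ⟨g, h1, fun u v => (hρ.wl_add_iff u _).2 (h2 u v),
    fun u v y hy hy' => h3 u v y hy ((hρ.wl_add_iff u y).1 hy')⟩

namespace IsCap

variable {cap : M.Group → M.Group → M.Group} (hc : IsCap cap)
include hc

omit [Fintype B] [DecidableEq B]

theorem cap_one_left (v : M.Group) : cap 1 v = v :=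
  (hc.pre 1 v).antisymm (hc.max 1 v v (Pre.refl v) (by simp [wl_one]))

theorem cap_mul_pre {u₁ u₂ : M.Group} (h : wl M (u₁ * u₂) = wl M u₁ + wl M u₂) (v : M.Group) :
    Pre (cap (u₁ * u₂) v) (cap u₂ v) := by
  refine hc.max _ _ _ (hc.pre _ _) ?_
  have h1 := hc.add (u₁ * u₂) v
  have h2 := wl_mul_le u₁ (u₂ * cap (u₁ * u₂) v)
  rw [← mul_assoc] at h2
  have h3 := wl_mul_le u₂ (cap (u₁ * u₂) v)
  omega

theorem cap_mul {u₁ u₂ : M.Group} (h : wl M (u₁ * u₂) = wl M u₁ + wl M u₂) (v : M.Group) :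
    cap u₁ (u₂ * cap u₂ v) = u₂ * cap (u₁ * u₂) v := by
  have h1 := hc.add (u₁ * u₂) v
  have h2 := hc.cap_mul_pre h v
  have h3 := hc.add u₂ v
  have h4 := h2.add_of_add h3
  refine Pre.antisymm ?_ ?_
  · set y := cap u₁ (u₂ * cap u₂ v) with hy
    have hu : Pre u₂ y := hc.max _ _ _ (pre_mul h3) h
    have hy1 := hc.pre u₁ (u₂ * cap u₂ v)
    have hy2 := hc.add u₁ (u₂ * cap u₂ v)
    rw [← hy] at hy1 hy2
    obtain ⟨x, hx⟩ : ∃ x, y = u₂ * x := ⟨u₂⁻¹ * y, by group⟩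
    rw [hx] at hu hy1 hy2 ⊢
    have hux : wl M (u₂ * x) = wl M u₂ + wl M x := by
      unfold Pre at hu
      rw [inv_mul_cancel_left] at hu
      omega
    rw [pre_mul_left_iff hux h3] at hy1
    rw [pre_mul_left_iff hux h4]
    refine hc.max _ _ _ (hy1.trans (hc.pre _ _)) ?_
    rw [mul_assoc]
    omega
  · refine hc.max _ _ _ ((pre_mul_left_iff h4 h3).2 h2) ?_
    rw [← mul_assoc]
    omega

end IsCap

end Parabolic

/-! ### The positive monoid and its Garside structure -/

section Monoid

variable {B : Type*} {M : CoxeterMatrix B}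

variable (M) in
/-- The braid relations on the free monoid. -/
def posRel (a b : FreeMonoid B) : Prop :=
  ∃ s t : B, s ≠ t ∧ M s t ≠ 0 ∧ a = FreeMonoid.ofList (altList s t (M s t)) ∧
    b = FreeMonoid.ofList (altList t s (M s t))

variable (M) in
/-- The abstract positive monoid presented by the braid relations. -/
abbrev PosMonoid : Type _ := PresentedMonoid (posRel M)

variable (M) in
/-- The standard generators of the abstract positive monoid. -/
def pgen (s : B) : PosMonoid M := PresentedMonoid.of (posRel M) s

variable (M) in
/-- The element of the positive monoid spelled by a word. -/
def pword (l : List B) : PosMonoid M := (l.map (pgen M)).prod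

@[simp] theorem pword_nil : pword M [] = 1 := rfl

@[simp] theorem pword_cons (s : B) (l : List B) : pword M (s :: l) = pgen M s * pword M l := by
  simp [pword]

theorem pword_append (l l' : List B) : pword M (l ++ l') = pword M l * pword M l' := by
  simp [pword]

theorem mk_ofList (l : List B) :
    PresentedMonoid.mk (posRel M) (FreeMonoid.ofList l) = pword M l := by
  induction l with
  | nil => rfl
  | cons s l ih => rw [FreeMonoid.ofList_cons, map_mul, ih, pword_cons]; rfl

theorem pword_braid {s t : B} (hst : s ≠ t) (hm : M s t ≠ 0) :
    pword M (altList s t (M s t)) = pword M (altList t s (M s t)) := by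
  rw [← mk_ofList, ← mk_ofList]
  exact PresentedMonoid.mk_eq_mk_of_rel ⟨s, t, hst, hm, rfl, rfl⟩

theorem exists_pword (a : PosMonoid M) : ∃ l, pword M l = a := by
  induction a using PresentedMonoid.inductionOn with
  | h a => exact ⟨FreeMonoid.toList a, by rw [← mk_ofList]; rfl⟩

/-- The monoid homomorphism from the positive monoid extending a map on the generators that
satisfies the braid relations. -/
def pLift {N : Type*} [Monoid N] (f : B → N)
    (hf : ∀ s t, s ≠ t → M s t ≠ 0 →
      ((altList s t (M s t)).map f).prod = ((altList t s (M s t)).map f).prod) :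
    PosMonoid M →* N :=
  PresentedMonoid.lift f (by
    rintro _ _ ⟨s, t, hst, hm, rfl, rfl⟩
    simpa [FreeMonoid.lift_apply] using hf s t hst hm)

theorem pLift_pgen {N : Type*} [Monoid N] (f : B → N) (hf) (s : B) :
    pLift (M := M) f hf (pgen M s) = f s :=
  PresentedMonoid.lift_of f _

theorem pLift_pword {N : Type*} [Monoid N] (f : B → N) (hf) (l : List B) :
    pLift (M := M) f hf (pword M l) = (l.map f).prod := by
  rw [pword, map_list_prod, List.map_map]
  congr 2

theorem wl_add_wl_of_reduced {l l' : List B} (h : wl M (wp M (l ++ l')) = (l ++ l').length) :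
    wl M (wp M l) = l.length ∧ wl M (wp M l') = l'.length := by
  rw [wp_append, List.length_append] at h
  have h1 := wl_mul_le (wp M l) (wp M l')
  have h2 := wl_wp_le (M := M) l
  have h3 := wl_wp_le (M := M) l'
  omega

theorem exists_reduced (w : M.Group) : ∃ l, wl M (wp M l) = l.length ∧ wp M l = w := by
  obtain ⟨l, hl, rfl⟩ := M.toCoxeterSystem.exists_isReduced w
  exact ⟨l, hl, rfl⟩

variable [Fintype B] [DecidableEq B] {ρ : M.Group →* Module.End ℝ (B → ℝ)}

/-- Two reduced words of the same element are related by braid relations. -/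
theorem IsGeom.pword_eq_of_reduced (hρ : IsGeom M ρ) {l l' : List B}
    (hl : wl M (wp M l) = l.length) (hl' : wl M (wp M l') = l'.length)
    (h : wp M l = wp M l') : pword M l = pword M l' := by
  induction hn : l.length generalizing l l' with
  | zero =>
    have h1 : l = [] := List.length_eq_zero_iff.1 hn
    have h2 : l' = [] := by
      rw [← List.length_eq_zero_iff, ← hl', ← h, hl, hn]
    rw [h1, h2]
  | succ n ih =>
    have red : ∀ {x : B} {l : List B}, wl M (wp M (x :: l)) = (x :: l).length →
        wl M (wp M l) = l.length := fun {x l} hx => (wl_add_wl_of_reduced (l := [x]) hx).2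
    have key : ∀ {x : B} {l l' : List B}, (x :: l).length = n + 1 →
        wl M (wp M (x :: l)) = (x :: l).length → wl M (wp M (x :: l')) = (x :: l').length →
        wp M (x :: l) = wp M (x :: l') → pword M (x :: l) = pword M (x :: l') := by
      intro x l l' hx h1 h2 h3
      rw [wp_cons, wp_cons, mul_right_inj] at h3
      rw [pword_cons, pword_cons, ih (red h1) (red h2) h3 (by simpa using hx)]
    match l, l' with
    | [], _ => simp at hn
    | s :: l, [] => rw [← h, hl] at hl'; simp at hl'
    | s :: l, t :: l' =>
      by_cases hst : s = t
      · subst hst; exact key hn hl hl' h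
      have hll : (t :: l').length = n + 1 := by rw [← hl', ← h, hl, hn]
      have h1 : wl M (M.simple s * wp M (s :: l)) < wl M (wp M (s :: l)) := by
        rw [hl, wp_cons, simple_mul_cancel, red hl]; simp
      have h2 : wl M (M.simple t * wp M (s :: l)) < wl M (wp M (s :: l)) := by
        rw [h, hl', wp_cons, simple_mul_cancel, red hl']; simp
      obtain ⟨hm, v, hv, hlv⟩ := hρ.exists_braid_of_descents hst h1 h2
      obtain ⟨k, hk, rfl⟩ := exists_reduced v
      rw [← wp_append] at hv
      have hv' := hv
      rw [wp_append, ← wp_altList_symm, ← wp_append] at hv'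
      have r1 : wl M (wp M (altList t s (M s t) ++ k)) = (altList t s (M s t) ++ k).length := by
        rw [← hv, ← hlv, hk]; simp [add_comm]
      have r2 : wl M (wp M (altList s t (M s t) ++ k)) = (altList s t (M s t) ++ k).length := by
        rw [← hv', ← hlv, hk]; simp [add_comm]
      have e : pword M (altList s t (M s t) ++ k) = pword M (altList t s (M s t) ++ k) := by
        rw [pword_append, pword_append, pword_braid hst hm]
      obtain ⟨m, hm'⟩ := Nat.exists_eq_succ_of_ne_zero hm
      rw [hm', altList, List.cons_append] at r2 hv'
      rw [hm', altList, altList, List.cons_append, List.cons_append] at e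
      rw [hm', altList, List.cons_append] at r1 hv
      rw [key hn hl r2 hv', e]
      exact (key hll hl' r1 (h.symm.trans hv)).symm

variable (M) in
/-- The lift of an element of the Coxeter group to the positive monoid by reduced words. -/
noncomputable def blift (w : M.Group) : PosMonoid M :=
  pword M (Classical.choose (exists_reduced w))

theorem IsGeom.blift_wp (hρ : IsGeom M ρ) {l : List B} (hl : wl M (wp M l) = l.length) :
    blift M (wp M l) = pword M l := by
  have h := Classical.choose_spec (exists_reduced (wp M l))
  exact hρ.pword_eq_of_reduced h.1 hl h.2

theorem IsGeom.blift_simple (hρ : IsGeom M ρ) (s : B) : blift M (M.simple s) = pgen M s := by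
  have h := hρ.blift_wp (l := [s]) (by simp [wl_simple])
  simpa using h

theorem IsGeom.blift_one (hρ : IsGeom M ρ) : blift M 1 = 1 := by
  have h := hρ.blift_wp (l := []) (by simp [wl_one])
  simpa using h

theorem IsGeom.blift_mul (hρ : IsGeom M ρ) {u v : M.Group}
    (h : wl M (u * v) = wl M u + wl M v) : blift M (u * v) = blift M u * blift M v := by
  obtain ⟨l, hl, rfl⟩ := exists_reduced u
  obtain ⟨k, hk, rfl⟩ := exists_reduced v
  rw [hρ.blift_wp hl, hρ.blift_wp hk, ← pword_append, ← wp_append, hρ.blift_wp]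
  rw [wp_append, h, hl, hk, List.length_append]

theorem IsGeom.blift_pre (hρ : IsGeom M ρ) {x v : M.Group} (h : Pre x v) :
    blift M v = blift M x * blift M (x⁻¹ * v) := by
  rw [← hρ.blift_mul, mul_inv_cancel_left]
  rw [mul_inv_cancel_left, h]

/-- The action of a Coxeter group element on pairs. -/
noncomputable def capAct (cap : M.Group → M.Group → M.Group) (u : M.Group) :
    Function.End (M.Group × PosMonoid M) :=
  fun p => (u * cap u p.1, blift M ((cap u p.1)⁻¹ * p.1) * p.2)

theorem IsGeom.capAct_mul (hρ : IsGeom M ρ) {cap : M.Group → M.Group → M.Group} (hc : IsCap cap)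
    {u v : M.Group} (h : wl M (u * v) = wl M u + wl M v) :
    capAct cap (u * v) = capAct cap u * capAct cap v := by
  funext ⟨x, c⟩
  change _ = capAct cap u (capAct cap v (x, c))
  simp only [capAct]
  rw [hc.cap_mul h, ← mul_assoc, ← mul_assoc, mul_inv_rev, mul_assoc _ v⁻¹, inv_mul_cancel_left,
    ← hρ.blift_mul]
  · rw [mul_assoc _ (cap v x), mul_inv_cancel_left]
  · rw [mul_assoc _ (cap v x), mul_inv_cancel_left]
    have h1 := hc.cap_mul_pre h x
    have h2 := hc.pre v x
    have h3 := hc.pre (u * v) x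
    unfold Pre at *
    omega

theorem IsGeom.capAct_one (hρ : IsGeom M ρ) {cap : M.Group → M.Group → M.Group}
    (hc : IsCap cap) : capAct cap (1 : M.Group) = 1 := by
  funext ⟨x, c⟩
  simp only [capAct, hc.cap_one_left, inv_mul_cancel, hρ.blift_one, one_mul]
  rfl

theorem IsGeom.prod_capAct (hρ : IsGeom M ρ) {cap : M.Group → M.Group → M.Group}
    (hc : IsCap cap) {l : List B} (hl : wl M (wp M l) = l.length) :
    (l.map fun s => capAct cap (M.simple s)).prod = capAct cap (wp M l) := by
  induction l with
  | nil => simp [hρ.capAct_one hc]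
  | cons s l ih =>
    have h := wl_add_wl_of_reduced (l := [s]) hl
    rw [List.map_cons, List.prod_cons, ih h.2, wp_cons, hρ.capAct_mul hc]
    rw [← wp_cons, hl, wl_simple, h.2, List.length_cons, add_comm]

theorem IsGeom.eval_capAct (hρ : IsGeom M ρ) {cap : M.Group → M.Group → M.Group}
    (hc : IsCap cap) (s : B) (p : M.Group × PosMonoid M) :
    blift M (capAct cap (M.simple s) p).1 * (capAct cap (M.simple s) p).2 =
      pgen M s * (blift M p.1 * p.2) := by
  simp only [capAct]
  rw [hρ.blift_mul (hc.add _ _), hρ.blift_simple, hρ.blift_pre (hc.pre (M.simple s) p.1)]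
  simp only [mul_assoc]

/-- Evaluating the action at the trivial pair. -/
theorem IsGeom.eval_act (hρ : IsGeom M ρ) {cap : M.Group → M.Group → M.Group} (hc : IsCap cap)
    {act : PosMonoid M →* Function.End (M.Group × PosMonoid M)}
    (hact : ∀ s, act (pgen M s) = capAct cap (M.simple s)) (m : PosMonoid M) :
    blift M (act m (1, 1)).1 * (act m (1, 1)).2 = m := by
  obtain ⟨l, rfl⟩ := exists_pword m
  induction l with
  | nil =>
    rw [pword_nil, map_one]
    change blift M 1 * 1 = 1
    rw [hρ.blift_one, mul_one]
  | cons s l ih =>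
    rw [pword_cons, map_mul, hact]
    exact (hρ.eval_capAct hc s _).trans (by rw [ih])

variable [Finite M.Group]

theorem IsGeom.wl_braid (hρ : IsGeom M ρ) {s t : B} (hst : s ≠ t) :
    M s t ≠ 0 ∧ wl M (wp M (altList s t (M s t))) = M s t := by
  obtain ⟨hm, v, hv, hl⟩ := hρ.exists_braid_of_descents hst (a := longest M Set.univ)
    (pre_simple.1 (simple_pre_longest (Set.mem_univ s)))
    (pre_simple.1 (simple_pre_longest (Set.mem_univ t)))
  refine ⟨hm, ?_⟩
  rw [← wp_altList_symm] at hv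
  have h1 := wl_mul_le (wp M (altList s t (M s t))) v
  have h2 := wl_wp_le (M := M) (altList s t (M s t))
  rw [← hv] at h1
  rw [altList_length] at h2
  omega

/-- The positive monoid acts on pairs, extending the action of reduced words. -/
theorem IsGeom.exists_action (hρ : IsGeom M ρ) {cap : M.Group → M.Group → M.Group}
    (hc : IsCap cap) : ∃ act : PosMonoid M →* Function.End (M.Group × PosMonoid M),
      ∀ s, act (pgen M s) = capAct cap (M.simple s) := by
  refine ⟨pLift (fun s => capAct cap (M.simple s)) fun s t hst hm => ?_, pLift_pgen _ _⟩
  have h := (hρ.wl_braid hst).2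
  rw [hρ.prod_capAct hc (by rw [h, altList_length]), hρ.prod_capAct hc, wp_altList_symm]
  rw [← wp_altList_symm, h, altList_length]

/-- The greatest simple left divisor of an element of the positive monoid, in the form needed
below. -/
theorem IsGeom.exists_alpha (hρ : IsGeom M ρ) : ∃ α : PosMonoid M → M.Group,
    (∀ m, ∃ c, m = blift M (α m) * c) ∧ ∀ s c, Pre (M.simple s) (α (pgen M s * c)) := by
  obtain ⟨cap, hc⟩ := hρ.exists_cap
  obtain ⟨act, hact⟩ := hρ.exists_action hc
  refine ⟨fun m => (act m (1, 1)).1, fun m => ⟨(act m (1, 1)).2, (hρ.eval_act hc hact m).symm⟩,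
    fun s c => ?_⟩
  have e : (act (pgen M s * c) (1, 1)).1 =
      M.simple s * cap (M.simple s) (act c (1, 1)).1 := by
    rw [map_mul, hact]
    rfl
  exact (congrArg (Pre (M.simple s)) e).mpr (pre_mul (hc.add _ _))

/-- Left cancellation by a generator in the positive monoid. -/
theorem IsGeom.pgen_mul_left_cancel (hρ : IsGeom M ρ) {s : B} {a b : PosMonoid M}
    (h : pgen M s * a = pgen M s * b) : a = b := by
  obtain ⟨cap, hc⟩ := hρ.exists_cap
  obtain ⟨act, hact⟩ := hρ.exists_action hc
  have retr : ∀ m, blift M (M.simple s * (act (pgen M s * m) (1, 1)).1) *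
      (act (pgen M s * m) (1, 1)).2 = m := by
    intro m
    rw [map_mul, hact]
    change blift M (M.simple s * (capAct cap (M.simple s) (act m (1, 1))).1) *
      (capAct cap (M.simple s) (act m (1, 1))).2 = m
    simp only [capAct]
    rw [simple_mul_cancel, ← mul_assoc, ← hρ.blift_pre (hc.pre _ _),
      hρ.eval_act hc hact]
  rw [← retr a, h, retr b]

theorem IsGeom.mul_left_cancel (hρ : IsGeom M ρ) {m a b : PosMonoid M}
    (h : m * a = m * b) : a = b := by
  obtain ⟨l, rfl⟩ := exists_pword m
  induction l with
  | nil => simpa using h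
  | cons s l ih =>
    rw [pword_cons, mul_assoc, mul_assoc] at h
    exact ih (hρ.pgen_mul_left_cancel h)

theorem IsGeom.blift_longest_dvd (hρ : IsGeom M ρ) {Z : Set B} {m : PosMonoid M}
    (h : ∀ s ∈ Z, ∃ c, pgen M s * c = m) : ∃ c, blift M (longest M Z) * c = m := by
  obtain ⟨α, h1, h2⟩ := hρ.exists_alpha
  obtain ⟨c, hc⟩ := h1 m
  have : Pre (longest M Z) (α m) := hρ.longest_pre fun s hs => by
    obtain ⟨c, rfl⟩ := h s hs
    exact h2 s c
  exact ⟨_, by conv_rhs => rw [hc, hρ.blift_pre this, mul_assoc]⟩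

end Monoid

/-! ### Conjugation by longest elements -/

section Longest

variable {B : Type*} {M : CoxeterMatrix B} [Finite M.Group] [Fintype B] [DecidableEq B]
  {ρ : M.Group →* Module.End ℝ (B → ℝ)}

namespace IsGeom

variable (hρ : IsGeom M ρ)
include hρ

theorem wl_longest_mul {Z : Set B} {x : M.Group} (hx : x ∈ coxSub M Z) :
    wl M (longest M Z * x) + wl M x = wl M (longest M Z) :=
  wl_mul_of_right_descents hρ (fun s hs => by
    have := longest_mul_simple (M := M) hs
    omega) hx

theorem longest_mul_self (Z : Set B) : longest M Z * longest M Z = 1 := by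
  have h := wl_longest_mul hρ (longest_mem (M := M) Z)
  exact wl_eq_zero.1 (by omega)

theorem longest_conj {Z : Set B} {s : B} (hs : s ∈ Z) : ∃ r ∈ Z,
    longest M Z * M.simple s = M.simple r * longest M Z ∧
      longest M Z * M.simple r = M.simple s * longest M Z := by
  have hinv : (longest M Z)⁻¹ = longest M Z := inv_eq_of_mul_eq_one_left (longest_mul_self hρ Z)
  have hmem := mul_mem (simple_mem_coxSub (M := M) hs) (longest_mem (M := M) Z)
  have h1 := wl_longest_mul hρ hmem
  have h2 := simple_mul_longest (M := M) hs
  obtain ⟨r, hr⟩ := wl_eq_one.1 (show wl M (longest M Z * (M.simple s * longest M Z)) = 1 by omega)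
  refine ⟨r, ?_, ?_, ?_⟩
  · refine mem_of_right_descent hρ (mul_mem (longest_mem (M := M) Z) hmem) ?_
    rw [hr, simple_mul_self, wl_one, wl_simple]
    exact one_pos
  · rw [← hr]
    simp only [mul_assoc, longest_mul_self hρ, mul_one]
  · rw [← hr, ← mul_assoc, longest_mul_self hρ, one_mul]

theorem blift_longest_left {Z : Set B} {s : B} (hs : s ∈ Z) :
    blift M (longest M Z) = pgen M s * blift M (M.simple s * longest M Z) := by
  have := hρ.blift_pre (simple_pre_longest (M := M) hs)
  rwa [simple_inv, hρ.blift_simple] at this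

theorem blift_longest_right {Z : Set B} {s : B} (hs : s ∈ Z) :
    blift M (longest M Z) = blift M (longest M Z * M.simple s) * pgen M s := by
  rw [← hρ.blift_simple, ← hρ.blift_mul, mul_simple_cancel]
  rw [mul_simple_cancel, wl_simple, longest_mul_simple hs]

theorem blift_longest_conj {Z : Set B} {s r : B} (hs : s ∈ Z) (hr : r ∈ Z)
    (h : longest M Z * M.simple s = M.simple r * longest M Z) :
    blift M (longest M Z) * pgen M s = pgen M r * blift M (longest M Z) := by
  conv_rhs => rw [blift_longest_right hρ hs, h]
  rw [← mul_assoc, ← blift_longest_left hρ hr]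

end IsGeom

end Longest

/-! ### The positive monoid embeds in the Artin-Tits group -/

section Embedding

universe u

variable {B : Type*} {M : CoxeterMatrix B}

theorem gen_braid {s t : B} (hst : s ≠ t) (hm : M s t ≠ 0) :
    ((altList s t (M s t)).map (gen M)).prod = ((altList t s (M s t)).map (gen M)).prod := by
  have h : PresentedGroup.mk (braidRels M) (((altList s t (M s t)).map FreeGroup.of).prod *
      (((altList t s (M s t)).map FreeGroup.of).prod)⁻¹) = 1 :=
    PresentedGroup.one_of_mem ⟨s, t, hst, hm, rfl⟩
  rw [map_mul, map_inv, mul_inv_eq_one, map_list_prod, map_list_prod, List.map_map,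
    List.map_map] at h
  exact h

variable (M) in
/-- The canonical map from the positive monoid to the Artin-Tits group. -/
def toArtin : PosMonoid M →* Artin M := pLift (gen M) fun _ _ => gen_braid

theorem toArtin_pgen (s : B) : toArtin M (pgen M s) = gen M s := pLift_pgen _ _ s

theorem toArtin_pword (l : List B) : toArtin M (pword M l) = (l.map (gen M)).prod :=
  pLift_pword _ _ l

theorem prod_map_altList {N : Type*} [Monoid N] {f : B → N} {s t : B} (a : N) (hs : f s = a)
    (ht : f t = a) (n : ℕ) : ((altList s t n).map f).prod = a ^ n := by
  induction n generalizing s t with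
  | zero => simp [altList]
  | succ n ih => rw [altList, List.map_cons, List.prod_cons, ih ht hs, hs, pow_succ']

/-- Extension of a map on generators satisfying the braid relations to the Artin-Tits group. -/
def artinLift {G : Type*} [Group G] (f : B → G)
    (hf : ∀ s t, s ≠ t → M s t ≠ 0 →
      ((altList s t (M s t)).map f).prod = ((altList t s (M s t)).map f).prod) :
    Artin M →* G :=
  PresentedGroup.toGroup (f := f) (by
    rintro r ⟨s, t, hst, hm, rfl⟩
    rw [map_mul, map_inv, mul_inv_eq_one, map_list_prod, map_list_prod, List.map_map,
      List.map_map]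
    simpa [Function.comp_def] using hf s t hst hm)

theorem artinLift_gen {G : Type*} [Group G] (f : B → G) (hf) (s : B) :
    artinLift (M := M) f hf (gen M s) = f s :=
  PresentedGroup.toGroup.of _

theorem proj_gen (s : B) : proj M (gen M s) = M.simple s :=
  PresentedGroup.toGroup.of _

variable (M) in
/-- The degree homomorphism, sending each generator to one. -/
def degHom : Artin M →* Multiplicative ℤ :=
  artinLift (fun _ => Multiplicative.ofAdd 1) fun s t _ _ => by
    rw [List.map_const', List.map_const', altList_length, altList_length]

variable (M) in
/-- The degree of an element of the Artin-Tits group. -/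
def deg (g : Artin M) : ℤ := (degHom M g).toAdd

theorem deg_mul (g h : Artin M) : deg M (g * h) = deg M g + deg M h := by simp [deg]

theorem deg_one : deg M 1 = 0 := by simp [deg]

theorem deg_gen (s : B) : deg M (gen M s) = 1 := by simp [deg, degHom, artinLift_gen]

theorem deg_prod (l : List B) : deg M ((l.map (gen M)).prod) = l.length := by
  induction l with
  | nil => simp [deg_one]
  | cons s l ih => simp [deg_mul, ih, deg_gen, add_comm]

theorem mem_posMonOn {Z : Set B} {g : Artin M} :
    g ∈ posMonOn M Z ↔ ∃ l : List B, (∀ s ∈ l, s ∈ Z) ∧ (l.map (gen M)).prod = g := by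
  constructor
  · intro h
    induction h using Submonoid.closure_induction with
    | mem x hx =>
      obtain ⟨s, hs, rfl⟩ := hx
      exact ⟨[s], by simpa using hs, by simp⟩
    | one => exact ⟨[], by simp, rfl⟩
    | mul x y _ _ hx hy =>
      obtain ⟨l, hl, rfl⟩ := hx
      obtain ⟨k, hk, rfl⟩ := hy
      refine ⟨l ++ k, fun s hs => ?_, by simp⟩
      rcases List.mem_append.1 hs with h | h
      · exact hl s h
      · exact hk s h
  · rintro ⟨l, hl, rfl⟩
    refine Submonoid.list_prod_mem _ fun x hx => ?_
    obtain ⟨s, hs, rfl⟩ := List.mem_map.1 hx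
    exact Submonoid.subset_closure ⟨s, hl s hs, rfl⟩

theorem posMon_eq : posMon M = posMonOn M Set.univ := by rw [posMon, posMonOn, Set.image_univ]

theorem mem_posMon {g : Artin M} : g ∈ posMon M ↔ ∃ m, toArtin M m = g := by
  rw [posMon_eq, mem_posMonOn]
  constructor
  · rintro ⟨l, -, rfl⟩
    exact ⟨_, toArtin_pword l⟩
  · rintro ⟨m, rfl⟩
    obtain ⟨l, rfl⟩ := exists_pword m
    exact ⟨l, fun _ _ => trivial, (toArtin_pword l).symm⟩

theorem deg_nonneg {g : Artin M} (h : g ∈ posMon M) : 0 ≤ deg M g := by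
  rw [posMon_eq, mem_posMonOn] at h
  obtain ⟨l, -, rfl⟩ := h
  rw [deg_prod]
  positivity

theorem eq_one_of_deg {g : Artin M} (h : g ∈ posMon M) (h0 : deg M g = 0) : g = 1 := by
  rw [posMon_eq, mem_posMonOn] at h
  obtain ⟨l, -, rfl⟩ := h
  rw [deg_prod] at h0
  have : l = [] := List.length_eq_zero_iff.1 (by exact_mod_cast h0)
  simp [this]

theorem posMonOn_le (Z : Set B) : posMonOn M Z ≤ posMon M :=
  Submonoid.closure_mono (Set.image_subset_range _ _)

theorem IsDelta.unique {Z : Set B} {d d' : Artin M} (h : IsDelta M Z d) (h' : IsDelta M Z d') :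
    d = d' := by
  obtain ⟨c, hc, e⟩ := h.2.2 d' h'.1 h'.2.1
  obtain ⟨c', hc', e'⟩ := h'.2.2 d h.1 h.2.1
  have h1 := deg_nonneg (posMonOn_le Z hc)
  have h2 := deg_nonneg (posMonOn_le Z hc')
  have h3 := congrArg (deg M) e
  have h4 := congrArg (deg M) e'
  rw [deg_mul] at h3 h4
  rw [eq_one_of_deg (posMonOn_le Z hc) (by omega), mul_one] at e
  exact e

/-- The letters of a word depend only on the element of the positive monoid it spells. -/
theorem forall_mem_of_pword_eq {Z : Set B} {l l' : List B} (h : pword M l = pword M l')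
    (hl : ∀ s ∈ l, s ∈ Z) : ∀ s ∈ l', s ∈ Z := by
  classical
  set f : B → ℕ := fun s => if s ∈ Z then 1 else 0 with hf
  have hfb : ∀ s t, s ≠ t → M s t ≠ 0 →
      ((altList s t (M s t)).map f).prod = ((altList t s (M s t)).map f).prod := by
    intro s t hst hm
    have h1 : M s t ≠ 1 := M.off_diagonal s t hst
    obtain ⟨n, hn⟩ : ∃ n, M s t = n + 2 := ⟨M s t - 2, by omega⟩
    by_cases hs : s ∈ Z
    · by_cases ht : t ∈ Z
      · rw [prod_map_altList 1 (by simp [hf, hs]) (by simp [hf, ht]),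
          prod_map_altList 1 (by simp [hf, ht]) (by simp [hf, hs])]
      · simp [hn, altList, hf, ht]
    · simp [hn, altList, hf, hs]
  have key : ∀ k : List B, (k.map f).prod = 1 ↔ ∀ s ∈ k, s ∈ Z := by
    intro k
    induction k with
    | nil => simp
    | cons s k ih =>
      rw [List.map_cons, List.prod_cons, mul_eq_one, ih]
      simp [hf]
  rw [← key, ← pLift_pword f hfb, ← h, pLift_pword, key]
  exact hl

/-- A monoid with left cancellation and a central element embeds in the localization. -/
theorem exists_localization {P : Type u} [Monoid P] (D : P) (hD : ∀ m, Commute D m)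
    (hcancel : ∀ m a b : P, m * a = m * b → a = b) :
    ∃ (L : Type u) (_ : Monoid L) (ι : P →* L), Function.Injective ι ∧ IsUnit (ι D) := by
  have hcomm : ∀ (s : Submonoid.powers D) (m : P), (s : P) * m = m * s := by
    rintro ⟨_, n, rfl⟩ m
    exact (hD m).pow_left n
  let _ : OreLocalization.OreSet (Submonoid.powers D) :=
    { ore_right_cancel := fun r₁ r₂ s h => ⟨s, by rw [hcomm, hcomm, h]⟩
      oreNum := fun r _ => r
      oreDenom := fun _ s => s
      ore_eq := fun r s => hcomm s r }
  refine ⟨OreLocalization (Submonoid.powers D) P, inferInstance, OreLocalization.numeratorHom,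
    fun a b h => ?_, OreLocalization.numerator_isUnit
      (⟨D, Submonoid.mem_powers D⟩ : Submonoid.powers D)⟩
  rw [OreLocalization.numeratorHom_apply, OreLocalization.numeratorHom_apply,
    OreLocalization.oreDiv_eq_iff] at h
  obtain ⟨u, v, h1, h2⟩ := h
  rw [Submonoid.coe_one, mul_one, mul_one] at h2
  rw [← h2, Submonoid.smul_def, smul_eq_mul, smul_eq_mul] at h1
  exact (hcancel _ _ _ h1).symm

variable (M) in
/-- The positive lift of an element of the Coxeter group to the Artin-Tits group. -/
noncomputable def alift (w : M.Group) : Artin M := toArtin M (blift M w)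

theorem alift_mem_posMon (w : M.Group) : alift M w ∈ posMon M := mem_posMon.2 ⟨_, rfl⟩

theorem proj_alift (w : M.Group) : proj M (alift M w) = w := by
  have h := (Classical.choose_spec (exists_reduced w)).2
  rw [alift, blift, toArtin_pword, map_list_prod, List.map_map]
  conv_rhs => rw [← h, wp]
  congr 2

theorem deg_alift (w : M.Group) : deg M (alift M w) = wl M w := by
  have h := Classical.choose_spec (exists_reduced w)
  rw [alift, blift, toArtin_pword, deg_prod, ← h.1, h.2]

variable [Fintype B] [DecidableEq B] {ρ : M.Group →* Module.End ℝ (B → ℝ)}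

theorem IsGeom.alift_mul (hρ : IsGeom M ρ) {u v : M.Group}
    (h : wl M (u * v) = wl M u + wl M v) : alift M (u * v) = alift M u * alift M v := by
  rw [alift, hρ.blift_mul h, map_mul, alift, alift]

theorem IsGeom.blift_eq_pword (hρ : IsGeom M ρ) {Z : Set B} {w : M.Group} (hw : w ∈ coxSub M Z) :
    ∃ l : List B, (∀ s ∈ l, s ∈ Z) ∧ pword M l = blift M w := by
  refine hρ.coxSub_induction (p := fun w => ∃ l : List B, (∀ s ∈ l, s ∈ Z) ∧ pword M l = blift M w)
    ⟨[], by simp, hρ.blift_one.symm⟩ ?_ hw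
  rintro x - s hs hl ⟨l, h1, h2⟩
  refine ⟨l ++ [s], ?_, ?_⟩
  · intro r hr
    rcases List.mem_append.1 hr with h | h
    · exact h1 r h
    · rw [List.mem_singleton.1 h]; exact hs
  · rw [hρ.blift_mul (by rw [hl, wl_simple]), hρ.blift_simple, pword_append, h2]
    simp

theorem IsGeom.alift_mem_posMonOn (hρ : IsGeom M ρ) {Z : Set B} {w : M.Group}
    (hw : w ∈ coxSub M Z) : alift M w ∈ posMonOn M Z := by
  obtain ⟨l, h1, h2⟩ := hρ.blift_eq_pword hw
  exact mem_posMonOn.2 ⟨l, h1, by rw [alift, ← h2, toArtin_pword]⟩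

variable [Finite M.Group]

theorem IsGeom.toArtin_injective (hρ : IsGeom M ρ) : Function.Injective (toArtin M) := by
  set Δ := blift M (longest M Set.univ) with hΔ
  have hD : ∀ m, Commute (Δ * Δ) m := by
    intro m
    obtain ⟨l, rfl⟩ := exists_pword m
    induction l with
    | nil => exact Commute.one_right _
    | cons s l ih =>
      rw [pword_cons]
      refine Commute.mul_right ?_ ih
      obtain ⟨r, -, h1, h2⟩ := hρ.longest_conj (M := M) (Set.mem_univ s)
      have e1 := hρ.blift_longest_conj (Set.mem_univ s) (Set.mem_univ r) h1
      have e2 := hρ.blift_longest_conj (Set.mem_univ r) (Set.mem_univ s) h2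
      rw [← hΔ] at e1 e2
      rw [commute_iff_eq, mul_assoc, e1, ← mul_assoc, e2, mul_assoc]
  obtain ⟨L, _, ι, hι, u, hu⟩ := exists_localization (Δ * Δ) hD fun m a b => hρ.mul_left_cancel
  have hunit : ∀ s, IsUnit (ι (pgen M s)) := by
    intro s
    rw [isUnit_iff_exists_and_exists]
    constructor
    · refine ⟨ι (blift M (M.simple s * longest M Set.univ) * Δ) * ↑u⁻¹, ?_⟩
      rw [← mul_assoc, ← map_mul, ← mul_assoc, ← hρ.blift_longest_left (Set.mem_univ s), ← hu,
        Units.mul_inv]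
    · refine ⟨↑u⁻¹ * ι (Δ * blift M (longest M Set.univ * M.simple s)), ?_⟩
      rw [mul_assoc, ← map_mul, mul_assoc, ← hρ.blift_longest_right (Set.mem_univ s), ← hu,
        Units.inv_mul]
  choose f hf using hunit
  have hprod : ∀ l : List B, (((l.map f).prod : Lˣ) : L) = ι (pword M l) := by
    intro l
    induction l with
    | nil => simp
    | cons s l ih => rw [List.map_cons, List.prod_cons, Units.val_mul, ih, hf, pword_cons, map_mul]
  have hfb : ∀ s t, s ≠ t → M s t ≠ 0 →
      ((altList s t (M s t)).map f).prod = ((altList t s (M s t)).map f).prod := by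
    intro s t hst hm
    rw [Units.ext_iff, hprod, hprod, pword_braid hst hm]
  have key : ∀ m, ((artinLift f hfb (toArtin M m) : Lˣ) : L) = ι m := by
    intro m
    obtain ⟨l, rfl⟩ := exists_pword m
    rw [← hprod, toArtin_pword, map_list_prod, List.map_map]
    congr 3
    funext s
    exact artinLift_gen f hfb s
  intro a b h
  exact hι (by rw [← key, h, key])

/-- The positive lift of the longest element of `W_Z` is the Garside element of `Z`. -/
theorem IsGeom.isDelta_longest (hρ : IsGeom M ρ) (Z : Set B) :
    IsDelta M Z (alift M (longest M Z)) := by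
  refine ⟨hρ.alift_mem_posMonOn (longest_mem Z), fun s hs => ?_, fun m hm hdiv => ?_⟩
  · refine ⟨alift M (M.simple s * longest M Z), hρ.alift_mem_posMonOn
      (mul_mem (simple_mem_coxSub (M := M) hs) (longest_mem Z)), ?_⟩
    rw [alift, alift, hρ.blift_longest_left hs, map_mul, toArtin_pgen]
  · obtain ⟨l, hl, rfl⟩ := mem_posMonOn.1 hm
    have h : ∀ s ∈ Z, ∃ c, pgen M s * c = pword M l := by
      intro s hs
      obtain ⟨c, hc, e⟩ := hdiv s hs
      obtain ⟨k, -, rfl⟩ := mem_posMonOn.1 hc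
      refine ⟨pword M k, hρ.toArtin_injective ?_⟩
      rw [map_mul, toArtin_pgen, toArtin_pword, toArtin_pword, e]
    obtain ⟨c, hc⟩ := hρ.blift_longest_dvd h
    obtain ⟨k, rfl⟩ := exists_pword c
    obtain ⟨j, -, hj⟩ := hρ.blift_eq_pword (longest_mem (M := M) Z)
    rw [← hj, ← pword_append] at hc
    have hk := forall_mem_of_pword_eq hc.symm hl
    refine ⟨(k.map (gen M)).prod,
      mem_posMonOn.2 ⟨k, fun s hs => hk s (List.mem_append_right _ hs), rfl⟩, ?_⟩
    rw [alift, ← hj, ← toArtin_pword, ← toArtin_pword, ← hc, pword_append, map_mul]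

end Embedding

/-! ### Ribbons -/

section Ribbons

variable {B : Type*} {M : CoxeterMatrix B}

theorem exists_mul_gen_of_rightMul_eq {X Y : Set B} {h : Artin M}
    (e : leftMul M Y h = rightMul M X h) {s : B} (hs : s ∈ X) :
    ∃ r ∈ Y, gen M r * h = h * gen M s :=
  e.ge ⟨s, hs, rfl⟩

theorem exists_gen_mul_of_leftMul_eq {X Y : Set B} {h : Artin M}
    (e : leftMul M Y h = rightMul M X h) {r : B} (hr : r ∈ Y) :
    ∃ s ∈ X, h * gen M s = gen M r * h :=
  e.le ⟨r, hr, rfl⟩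

theorem wl_proj_le_deg {g : Artin M} (hg : g ∈ posMon M) : (wl M (proj M g) : ℤ) ≤ deg M g := by
  rw [posMon_eq, mem_posMonOn] at hg
  obtain ⟨l, -, rfl⟩ := hg
  have e : proj M (l.map (gen M)).prod = wp M l := by
    rw [map_list_prod, List.map_map, wp]
    congr 2
  rw [deg_prod, e]
  exact_mod_cast wl_wp_le l

theorem IsRibbon.elem_trans {X Y Z : Set B} {g d : Artin M} (hg : IsRibbon M Y Z g)
    (hd : IsElemRibbon M X Y d) : IsRibbon M X Z (g * d) := by
  induction hg with
  | nil =>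
    rw [one_mul, ← mul_one d]
    exact IsRibbon.cons (IsRibbon.nil X) hd
  | cons _ h ih =>
    rw [mul_assoc]
    exact IsRibbon.cons ih h

theorem comp_subset (Z : Set B) (t : B) : comp M Z t ⊆ Z := fun _ h => h.1

theorem mem_comp_self {Z : Set B} {t : B} (ht : t ∈ Z) : t ∈ comp M Z t :=
  ⟨ht, Relation.ReflTransGen.refl⟩

theorem eq_two_of_notMem_comp {Z : Set B} {t s z : B} (hs : s ∈ Z) (hsc : s ∉ comp M Z t)
    (hz : z ∈ comp M Z t) : M z s = 2 := by
  by_contra h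
  refine hsc ⟨hs, hz.2.tail ⟨hz.1, hs, ?_, h⟩⟩
  rintro rfl
  exact hsc hz

theorem gen_commute {s z : B} (h : M z s = 2) : Commute (gen M z) (gen M s) := by
  have hne : z ≠ s := by
    rintro rfl
    rw [M.diagonal] at h
    omega
  have := gen_braid (M := M) hne (by omega)
  rw [h] at this
  rw [commute_iff_eq]
  simpa [altList] using this

theorem commute_of_mem_posMonOn {Z : Set B} {s : B} (h : ∀ z ∈ Z, M z s = 2) {g : Artin M}
    (hg : g ∈ posMonOn M Z) : Commute g (gen M s) := by
  induction hg using Submonoid.closure_induction with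
  | mem x hx =>
    obtain ⟨z, hz, rfl⟩ := hx
    exact gen_commute (h z hz)
  | one => exact Commute.one_left _
  | mul x y _ _ hx hy => exact hx.mul_left hy

theorem coxSub_mono {Z Z' : Set B} (h : Z ⊆ Z') : coxSub M Z ≤ coxSub M Z' :=
  Subgroup.closure_mono (Set.image_mono h)

section Roots

variable [DecidableEq B]

theorem esimple_injective : Function.Injective (esimple : B → B → ℝ) := by
  intro s t h
  by_contra hne
  have := congrFun h s
  simp [esimple, hne] at this

theorem esimple_nonneg (s : B) : (0 : B → ℝ) ≤ esimple s := Pi.single_nonneg.2 zero_le_one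

theorem apply_eq_zero_of_support [Fintype B] {X Y : Set B} (f : (B → ℝ) →ₗ[ℝ] (B → ℝ))
    (hf : ∀ s ∈ X, ∀ r ∉ Y, f (esimple s) r = 0) {u : B → ℝ} (hu : ∀ r ∉ X, u r = 0) {r : B}
    (hr : r ∉ Y) : f u r = 0 := by
  have e : u = ∑ s, u s • esimple s := by
    conv_lhs => rw [← Finset.univ_sum_single u]
    refine Finset.sum_congr rfl fun r _ => ?_
    rw [esimple, ← Pi.single_smul, smul_eq_mul, mul_one]
  rw [e, map_sum, Finset.sum_apply]
  refine Finset.sum_eq_zero fun s _ => ?_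
  rw [map_smul, Pi.smul_apply]
  by_cases hs : s ∈ X
  · rw [hf s hs r hr, smul_zero]
  · rw [hu s hs, zero_smul]

end Roots

variable [Fintype B] [DecidableEq B] {ρ : M.Group →* Module.End ℝ (B → ℝ)}

namespace IsGeom

variable (hρ : IsGeom M ρ)
include hρ

theorem gen_injective : Function.Injective (gen M) := by
  intro s t h
  have h' : M.simple s = M.simple t := by rw [← proj_gen, h, proj_gen]
  by_contra hne
  have h1 := congrFun (simple_self hρ s) s
  rw [h', simple_of_ne hρ t _ _ hne] at h1
  simp [esimple] at h1
  linarith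

theorem apply_eq_or_neg {w : M.Group} {s r : B} (h : w * M.simple s = M.simple r * w) :
    ρ w (esimple s) = esimple r ∨ ρ w (esimple s) = -esimple r := by
  have h1 := mul_apply ρ w (M.simple s) (esimple s)
  rw [h, mul_apply, simple_self hρ, map_neg, hρ] at h1
  set c := bform M (ρ w (esimple s)) (esimple r) with hc
  have h2 : ρ w (esimple s) = c • esimple r := by
    have h3 : (2 : ℝ) • ρ w (esimple s) = (2 : ℝ) • (c • esimple r) := by
      rw [smul_smul, two_smul]
      linear_combination (exp := 1) h1
    exact smul_right_injective _ (two_ne_zero (α := ℝ)) h3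
  have h4 := bform_apply hρ w (esimple s) (esimple s)
  rw [h2, bform_smul_left, bform_smul_right, bform_esimple_self, bform_esimple_self, mul_one] at h4
  rcases mul_self_eq_one_iff.1 h4 with h5 | h5
  · left; rw [h2, h5, one_smul]
  · right; rw [h2, h5, neg_one_smul]

theorem apply_eq_of_nonneg {w : M.Group} {s r : B} (h : w * M.simple s = M.simple r * w)
    (h0 : 0 ≤ ρ w (esimple s)) : ρ w (esimple s) = esimple r := by
  refine (apply_eq_or_neg hρ h).resolve_right fun h1 => ?_
  have := h0 r
  rw [h1] at this
  simp [esimple] at this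
  linarith

theorem lreduced_of_stabilizer {Y : Set B} {g : Artin M}
    (hdeg : deg M g = wl M (proj M g)) (hY : ∀ s ∈ Y, 0 ≤ ρ (proj M g)⁻¹ (esimple s)) :
    lreduced M Y g := by
  rintro s hs ⟨c, hc, rfl⟩
  have h1 := lt_of_nonneg hρ (hY s hs)
  rw [← wl_simple_mul_inv, inv_inv, wl_inv] at h1
  have h2 := wl_proj_le_deg hc
  rw [deg_mul, deg_gen] at hdeg
  have e : M.simple s * proj M (gen M s * c) = proj M c := by
    rw [map_mul, proj_gen, simple_mul_cancel]
  rw [e] at h1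
  omega

variable [Finite M.Group]

theorem longest_apply {Z : Set B} {s : B} (hs : s ∈ Z) :
    ∃ r ∈ Z, ρ (longest M Z) (esimple s) = -esimple r := by
  obtain ⟨r, hr, h, -⟩ := longest_conj hρ hs
  refine ⟨r, hr, (apply_eq_or_neg hρ h).resolve_left fun h1 => ?_⟩
  have h2 := lt_of_nonneg hρ (w := longest M Z) (s := s) (by rw [h1]; exact esimple_nonneg r)
  have h3 := longest_mul_simple (M := M) hs
  omega

theorem longest_inv (Z : Set B) : (longest M Z)⁻¹ = longest M Z :=
  inv_eq_of_mul_eq_one_left (longest_mul_self hρ Z)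

theorem alift_longest_conj {Z : Set B} {s : B} (hs : s ∈ Z) : ∃ r ∈ Z,
    alift M (longest M Z) * gen M s = gen M r * alift M (longest M Z) := by
  obtain ⟨r, hr, h, -⟩ := longest_conj hρ hs
  refine ⟨r, hr, ?_⟩
  rw [alift, ← toArtin_pgen, ← toArtin_pgen, ← map_mul, ← map_mul,
    blift_longest_conj hρ hs hr h]

theorem inv_alift_longest_conj {Z : Set B} {s : B} (hs : s ∈ Z) : ∃ r ∈ Z,
    (alift M (longest M Z))⁻¹ * gen M s = gen M r * (alift M (longest M Z))⁻¹ := by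
  obtain ⟨r, hr, -, h⟩ := longest_conj hρ hs
  refine ⟨r, hr, ?_⟩
  rw [inv_mul_eq_iff_eq_mul, ← mul_assoc, eq_mul_inv_iff_mul_eq]
  rw [alift, ← toArtin_pgen, ← toArtin_pgen, ← map_mul, ← map_mul,
    blift_longest_conj hρ hr hs h]

/-- The quotient of two Garside elements is a positive lift. -/
theorem alift_longest_mul_longest {Z Z' : Set B} (h : Z' ⊆ Z) :
    alift M (longest M Z * longest M Z') =
      alift M (longest M Z) * (alift M (longest M Z'))⁻¹ := by
  have e : longest M Z * longest M Z' * longest M Z' = longest M Z := by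
    rw [mul_assoc, longest_mul_self hρ, mul_one]
  rw [eq_mul_inv_iff_mul_eq, ← alift_mul hρ, e]
  rw [e]
  exact (wl_longest_mul hρ (coxSub_mono h (longest_mem Z'))).symm

variable {X : Set B} {t : B}

theorem elem_apply_nonneg (ht : t ∉ X) {s : B} (hs : s ∈ X) :
    0 ≤ ρ (longest M (comp M (X ∪ {t}) t) * longest M (comp M (X ∪ {t}) t \ {t})) (esimple s) := by
  set Z := comp M (X ∪ {t}) t
  by_cases hsZ : s ∈ Z
  · obtain ⟨r, hr, h1⟩ := longest_apply hρ (Z := Z \ {t}) (s := s)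
      ⟨hsZ, by rintro rfl; exact ht hs⟩
    obtain ⟨q, -, h2⟩ := longest_apply hρ hr.1
    rw [mul_apply, h1, map_neg, h2, neg_neg]
    exact esimple_nonneg q
  · have hmem : longest M Z * longest M (Z \ {t}) ∈ coxSub M Z :=
      mul_mem (longest_mem Z) (coxSub_mono Set.sdiff_subset (longest_mem _))
    refine (nonneg_or_nonpos hρ _ s).resolve_right fun h => ?_
    have h1 := h s
    rw [apply_eq_of_mem hρ hmem _ hsZ] at h1
    simp [esimple] at h1
    linarith

theorem elem_conj (ht : t ∉ X) {s : B} (hs : s ∈ X) :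
    ∃ r ∈ X ∪ {t}, alift M (longest M (comp M (X ∪ {t}) t) *
        longest M (comp M (X ∪ {t}) t \ {t})) * gen M s =
      gen M r * alift M (longest M (comp M (X ∪ {t}) t) *
        longest M (comp M (X ∪ {t}) t \ {t})) := by
  set Z := comp M (X ∪ {t}) t
  rw [alift_longest_mul_longest hρ Set.sdiff_subset]
  by_cases hsZ : s ∈ Z
  · obtain ⟨r, hr, h1⟩ := inv_alift_longest_conj hρ (Z := Z \ {t}) (s := s)
      ⟨hsZ, by rintro rfl; exact ht hs⟩
    obtain ⟨q, hq, h2⟩ := alift_longest_conj hρ hr.1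
    refine ⟨q, comp_subset _ _ hq, ?_⟩
    rw [mul_assoc, h1, ← mul_assoc, h2, mul_assoc]
  · have h2 : ∀ z ∈ Z, M z s = 2 := fun z => eq_two_of_notMem_comp (Set.mem_union_left _ hs) hsZ
    have c1 := commute_of_mem_posMonOn h2 (alift_mem_posMonOn hρ (longest_mem Z))
    have c2 := commute_of_mem_posMonOn (fun z hz => h2 z (Set.sdiff_subset hz))
      (alift_mem_posMonOn hρ (longest_mem (Z \ {t})))
    exact ⟨s, Set.mem_union_left _ hs, c1.mul_left c2.inv_left⟩

theorem image_eq_of_elem (ht : t ∉ X) {X' : Set B}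
    (h : leftMul M X' (alift M (longest M (comp M (X ∪ {t}) t) *
        longest M (comp M (X ∪ {t}) t \ {t}))) =
      rightMul M X (alift M (longest M (comp M (X ∪ {t}) t) *
        longest M (comp M (X ∪ {t}) t \ {t})))) :
    ρ (longest M (comp M (X ∪ {t}) t) * longest M (comp M (X ∪ {t}) t \ {t})) '' (esimple '' X) =
      esimple '' X' := by
  have key : ∀ s ∈ X, ∀ r, alift M (longest M (comp M (X ∪ {t}) t) *
        longest M (comp M (X ∪ {t}) t \ {t})) * gen M s =
      gen M r * alift M (longest M (comp M (X ∪ {t}) t) *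
        longest M (comp M (X ∪ {t}) t \ {t})) →
      ρ (longest M (comp M (X ∪ {t}) t) * longest M (comp M (X ∪ {t}) t \ {t})) (esimple s) =
        esimple r := by
    intro s hs r e
    refine apply_eq_of_nonneg hρ ?_ (elem_apply_nonneg hρ ht hs)
    simpa only [map_mul, proj_gen, proj_alift] using congrArg (proj M) e
  refine Set.Subset.antisymm ?_ ?_
  · rintro _ ⟨_, ⟨s, hs, rfl⟩, rfl⟩
    obtain ⟨r, hr, e⟩ := exists_mul_gen_of_rightMul_eq h hs
    exact ⟨r, hr, (key s hs r e.symm).symm⟩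
  · rintro _ ⟨r, hr, rfl⟩
    obtain ⟨s, hs, e⟩ := exists_gen_mul_of_leftMul_eq h hr
    exact ⟨_, ⟨s, hs, rfl⟩, key s hs r e⟩

/-- A right descent of an element mapping `Π_X` to `Π_Y` splits off an elementary ribbon. -/
theorem exists_elem_split {Y : Set B} {w : M.Group}
    (hw : ρ w '' (esimple '' X) = esimple '' Y) (htw : wl M (w * M.simple t) < wl M w) :
    t ∉ X ∧ ∃ v, w = v * (longest M (comp M (X ∪ {t}) t) * longest M (comp M (X ∪ {t}) t \ {t})) ∧
      wl M v + wl M (longest M (comp M (X ∪ {t}) t) * longest M (comp M (X ∪ {t}) t \ {t})) =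
        wl M w ∧ wl M v < wl M w := by
  have hwX : ∀ s ∈ X, ∃ r ∈ Y, esimple r = ρ w (esimple s) := fun s hs =>
    hw.le ⟨_, ⟨s, hs, rfl⟩, rfl⟩
  have hwY : ∀ r ∈ Y, ∃ s ∈ X, ρ w (esimple s) = esimple r := fun r hr => by
    obtain ⟨_, ⟨s, hs, rfl⟩, e⟩ := hw.ge ⟨r, hr, rfl⟩
    exact ⟨s, hs, e⟩
  have hpos : ∀ s ∈ X, 0 ≤ ρ w (esimple s) := fun s hs => by
    obtain ⟨r, -, e⟩ := hwX s hs
    rw [← e]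
    exact esimple_nonneg r
  have ht : t ∉ X := fun h => by
    have := lt_of_nonneg hρ (hpos t h)
    omega
  refine ⟨ht, ?_⟩
  set Z := comp M (X ∪ {t}) t with hZ
  have htZ : t ∈ Z := mem_comp_self (Set.mem_union_right _ rfl)
  have hZX : Z \ {t} ⊆ X := fun s hs => (comp_subset _ _ hs.1).resolve_right hs.2
  have hdesc : ∀ s ∈ Z, wl M (w * longest M (Z \ {t}) * M.simple s) <
      wl M (w * longest M (Z \ {t})) := by
    intro s hs
    refine gt_of_nonpos hρ ?_
    by_cases hst : s = t
    · subst hst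
      obtain ⟨r, hrY, hr⟩ : ∃ r ∉ Y, ρ w (esimple s) r ≠ 0 := by
        by_contra! hcon
        have h1 := apply_eq_zero_of_support (X := Y) (Y := X) (ρ w⁻¹) (fun y hy r hr => by
          obtain ⟨x, hx, e⟩ := hwY y hy
          rw [← e, inv_apply_self, esimple, Pi.single_eq_of_ne]
          rintro rfl
          exact hr hx) hcon ht
        rw [inv_apply_self] at h1
        simp [esimple] at h1
      have h2 := apply_eq_zero_of_support (X := X) (Y := Y) (ρ w) (fun x hx r hr => by
          obtain ⟨y, hy, e⟩ := hwX x hx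
          rw [← e, esimple, Pi.single_eq_of_ne]
          rintro rfl
          exact hr hy) (u := ρ (longest M (Z \ {s})) (esimple s) - esimple s) (fun r hr => by
          rw [Pi.sub_apply, apply_eq_of_mem hρ (longest_mem _) _ fun h => hr (hZX h), sub_self]) hrY
      rw [map_sub, Pi.sub_apply, sub_eq_zero, ← mul_apply] at h2
      refine (nonneg_or_nonpos hρ _ s).resolve_left fun h3 => hr ?_
      refine le_antisymm (nonpos_of_gt hρ htw r) ?_
      rw [← h2]
      exact h3 r
    · obtain ⟨r, hr, e⟩ := longest_apply hρ (Z := Z \ {t}) (s := s) ⟨hs, hst⟩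
      rw [mul_apply, e, map_neg, neg_nonpos]
      exact hpos r (hZX hr)
  have h1 := wl_mul_of_right_descents hρ hdesc (longest_mem Z)
  have h2 := wl_mul_of_nonneg hρ (fun s hs => hpos s (hZX hs)) (longest_mem (M := M) (Z \ {t}))
  have hmem := coxSub_mono (M := M) (Set.sdiff_subset (s := Z) (t := {t})) (longest_mem (Z \ {t}))
  have h3 := wl_longest_mul hρ hmem
  have h4 : wl M (longest M Z * longest M (Z \ {t})) ≠ 0 := by
    intro h0
    rw [wl_eq_zero, mul_eq_one_iff_eq_inv, longest_inv hρ] at h0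
    have h5 := longest_mul_simple (M := M) htZ
    rw [h0] at h5
    exact (mem_of_right_descent hρ (longest_mem (Z \ {t})) (t := t) (by omega)).2 rfl
  refine ⟨w * longest M (Z \ {t}) * longest M Z, ?_, by omega, by omega⟩
  rw [mul_assoc, ← mul_assoc (longest M Z), longest_mul_self hρ, one_mul, mul_assoc,
    longest_mul_self hρ, mul_one]

theorem isElemRibbon_of_notMem (ht : t ∉ X) : ∃ X', IsElemRibbon M X X'
    (alift M (longest M (comp M (X ∪ {t}) t) * longest M (comp M (X ∪ {t}) t \ {t}))) ∧
    ρ (longest M (comp M (X ∪ {t}) t) * longest M (comp M (X ∪ {t}) t \ {t})) '' (esimple '' X) =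
      esimple '' X' := by
  choose! f hf hf' using fun s (hs : s ∈ X) => elem_conj hρ ht hs
  have e : leftMul M (f '' X) (alift M (longest M (comp M (X ∪ {t}) t) *
        longest M (comp M (X ∪ {t}) t \ {t}))) =
      rightMul M X (alift M (longest M (comp M (X ∪ {t}) t) *
        longest M (comp M (X ∪ {t}) t \ {t}))) := by
    rw [leftMul, rightMul, Set.image_image]
    exact Set.image_congr fun s hs => (hf' s hs).symm
  refine ⟨f '' X, ⟨t, inferInstanceAs (Finite (coxSub M _)), Or.inr ⟨ht, _, _,
    isDelta_longest hρ _, isDelta_longest hρ _, alift_longest_mul_longest hρ Set.sdiff_subset⟩,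
    Set.image_subset_iff.2 hf, e⟩, image_eq_of_elem hρ ht e⟩

/-- An element mapping `Π_X` to `Π_Y` lifts to a positive ribbon of the same length. -/
theorem exists_isRibbon {Y : Set B} {w : M.Group}
    (hw : ρ w '' (esimple '' X) = esimple '' Y) :
    ∃ g, IsRibbon M X Y g ∧ proj M g = w ∧ deg M g = wl M w := by
  induction hn : wl M w using Nat.strong_induction_on generalizing X w with
  | _ n ih =>
    subst hn
    by_cases h1 : w = 1
    · subst h1
      rw [map_one] at hw
      have : X = Y := esimple_injective.image_injective (by simpa using hw)
      subst this
      exact ⟨1, IsRibbon.nil X, map_one _, by rw [deg_one, wl_one]; rfl⟩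
    obtain ⟨t, htw⟩ := exists_right_descent h1
    obtain ⟨ht, v, hv, hl, hlt⟩ := exists_elem_split hρ hw htw
    obtain ⟨X', hX', hy⟩ := isElemRibbon_of_notMem hρ ht
    set y := longest M (comp M (X ∪ {t}) t) * longest M (comp M (X ∪ {t}) t \ {t})
    have hv' : ρ v '' (esimple '' X') = esimple '' Y := by
      rw [← hy, ← hw, Set.image_image, hv]
      simp only [mul_apply]
    obtain ⟨g, hg, hp, hd⟩ := ih _ hlt hv' rfl
    refine ⟨g * alift M y, hg.elem_trans hX', ?_, ?_⟩
    · rw [map_mul, hp, proj_alift, ← hv]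
    · rw [deg_mul, hd, deg_alift, ← hl, Nat.cast_add]

theorem elem_mem_posMon {Y : Set B} {h : Artin M} (hh : IsElemRibbon M X Y h) : h ∈ posMon M := by
  obtain ⟨t, -, ⟨-, hd⟩ | ⟨-, d₁, d₂, hd₁, hd₂, rfl⟩, -⟩ := hh
  · exact posMonOn_le _ hd.1
  · rw [hd₁.unique (isDelta_longest hρ _), hd₂.unique (isDelta_longest hρ _),
      ← alift_longest_mul_longest hρ Set.sdiff_subset]
    exact alift_mem_posMon _

theorem ribbon_mem_posMon {Y : Set B} {g : Artin M} (hg : IsRibbon M X Y g) : g ∈ posMon M := by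
  induction hg with
  | nil => exact one_mem _
  | cons _ h ih => exact mul_mem (elem_mem_posMon hρ h) ih

/-- A reduced positive ribbon maps simple roots to simple roots. -/
theorem image_eq_of_isRibbon {Y : Set B} {g : Artin M} (hg : IsRibbon M X Y g)
    (hred : lreduced M Y g) : ρ (proj M g) '' (esimple '' X) = esimple '' Y := by
  induction hg with
  | nil => simp
  | @cons Y Z g h hg hh ih =>
    have hpos := elem_mem_posMon hρ hh
    obtain ⟨t, -, ht, -, e⟩ := hh
    rcases ht with ⟨ht, hd⟩ | ⟨ht, d₁, d₂, hd₁, hd₂, rfl⟩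
    · exfalso
      have htZ : t ∈ comp M (Y ∪ {t}) t := mem_comp_self (Set.mem_union_right _ rfl)
      rw [hd.unique (isDelta_longest hρ _)] at e hred
      obtain ⟨r, hr, h1⟩ := alift_longest_conj hρ htZ
      obtain ⟨z, hz, h2⟩ := exists_mul_gen_of_rightMul_eq e ht
      rw [h1, mul_left_inj] at h2
      have h3 := gen_injective hρ h2
      subst h3
      obtain ⟨c, hc, h4⟩ := (isDelta_longest hρ (comp M (Y ∪ {t}) t)).2.1 z hr
      refine hred z hz ⟨c * g, mul_mem (posMonOn_le _ hc) (ribbon_mem_posMon hρ hg), ?_⟩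
      rw [← mul_assoc, h4]
    · have hg' : lreduced M Y g := by
        rintro s hs ⟨c, hc, rfl⟩
        obtain ⟨z, hz, h2⟩ := exists_mul_gen_of_rightMul_eq e hs
        refine hred z hz ⟨_, mul_mem hpos hc, ?_⟩
        rw [← mul_assoc, h2, mul_assoc]
      rw [hd₁.unique (isDelta_longest hρ _), hd₂.unique (isDelta_longest hρ _),
        ← alift_longest_mul_longest hρ Set.sdiff_subset] at e ⊢
      rw [← image_eq_of_elem hρ ht e, ← ih hg', map_mul, proj_alift]
      simp only [Set.image_image, mul_apply]

theorem image_proj_HXset (X : Set B) :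
    ⇑(proj M) '' HXset M X = {w : M.Group | ⇑(ρ w) '' (esimple '' X) = esimple '' X} := by
  ext w
  constructor
  · rintro ⟨_, ⟨g₁, g₂, h1, r1, h2, r2, rfl⟩, rfl⟩
    have e1 := image_eq_of_isRibbon hρ h1 r1
    have e2 := image_eq_of_isRibbon hρ h2 r2
    rw [Set.mem_ofPred_eq, map_mul, map_inv]
    conv_lhs => rw [← e2]
    rw [← e1, Set.image_image]
    conv_rhs => rw [← e1]
    simp only [mul_apply, Set.image_image, inv_apply_self]
  · intro hw
    obtain ⟨g, hg, hp, hd⟩ := exists_isRibbon hρ hw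
    refine ⟨g, ⟨g, 1, hg, ?_, IsRibbon.nil X, ?_, by simp⟩, hp⟩
    · refine lreduced_of_stabilizer hρ (by rw [hd, hp]) fun s hs => ?_
      obtain ⟨_, ⟨r, -, rfl⟩, e⟩ := hw.ge ⟨s, hs, rfl⟩
      rw [hp, ← e, inv_apply_self]
      exact esimple_nonneg r
    · refine lreduced_of_stabilizer hρ (by rw [map_one, wl_one, deg_one]; rfl) fun s hs => ?_
      rw [map_one, inv_one, map_one]
      exact esimple_nonneg s

end IsGeom

end Ribbons

/-- **Lemma (Godelle).** In a spherical-type Artin-Tits system, `p(H_X) = G_X`, where `G_X`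
is the stabilizer in `W_S` of the set `Π_X` of simple roots indexed by `X`, for the standard
geometric representation `ρ` of `W_S` on `E = B → ℝ` (each simple reflection acting by
`v ↦ v - 2(v, e_s)e_s`). -/
theorem proj_HXset_eq_simple_roots_stabilizer
    [Fintype B] [DecidableEq B] (M : CoxeterMatrix B) (hsph : Finite M.Group) (X : Set B)
    (ρ : M.Group →* Module.End ℝ (B → ℝ))
    (hρ : ∀ (s : B) (v : B → ℝ),
      ρ (M.simple s) v = v - (2 * bform M v (esimple s)) • esimple s) :
    ⇑(proj M) '' HXset M X
      = {w : M.Group | ⇑(ρ w) '' (esimple '' X) = esimple '' X} := by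
  have := hsph
  exact IsGeom.image_proj_HXset (show IsGeom M ρ from hρ) X

end ArtinTitsPaper
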